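/- Let F be a field of characteristic p such that the maximal dimension of an anisotropic homogeneous polynomial form of degree p over F is a finite integer d > 1. Then every central simple F-algebra of exponent p (equivalently, every element of the p-torsion of the Brauer group of F) is Brauer equivalent to a tensor product of at most ⌈(d−1)/p⌉ − 1 symbol algebras of degree p. -/

import Mathlib

open scoped TensorProduct

/-- The defining relations of the symbol `p`-algebra
`[a,b)_{p,F} = F⟨x,y : x^p - x = a, y^p = b, yx - xy = y⟩`. -/
inductive SymbolRel (F : Type) [Field F] (p : ℕ) (a b : F) :
    FreeAlgebra F (Fin 2) → FreeAlgebra F (Fin 2) → Prop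
  | x : SymbolRel F p a b (FreeAlgebra.ι F 0 ^ p - FreeAlgebra.ι F 0) (algebraMap F _ a)
  | y : SymbolRel F p a b (FreeAlgebra.ι F 1 ^ p) (algebraMap F _ b)
  | comm : SymbolRel F p a b
      (FreeAlgebra.ι F 1 * FreeAlgebra.ι F 0 - FreeAlgebra.ι F 0 * FreeAlgebra.ι F 1)
      (FreeAlgebra.ι F 1)

/-- The symbol `p`-algebra `[a,b)_{p,F}`. -/
abbrev SymbolAlg (F : Type) [Field F] (p : ℕ) (a b : F) : Type :=
  RingQuot (SymbolRel F p a b)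

/-- Two `F`-algebras are Brauer equivalent if they become isomorphic after tensoring
with matrix algebras, i.e. `M_n(A) ≅ M_m(B)` for some positive `n`, `m`. -/
def BrauerEquiv (F A B : Type) [Field F] [Ring A] [Ring B] [Algebra F A] [Algebra F B] :
    Prop :=
  ∃ (n m : ℕ), 0 < n ∧ 0 < m ∧
    Nonempty (Matrix (Fin n) (Fin n) A ≃ₐ[F] Matrix (Fin m) (Fin m) B)

/-- A pair of elements satisfying the defining relations of `[a,b)_{p,F}`. -/
structure IsSymbolPair {F R : Type*} [Field F] [Ring R] [Algebra F R] (p : ℕ) (a b : F)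
    (x y : R) : Prop where
  pow_sub : x ^ p - x = algebraMap F R a
  pow_eq : y ^ p = algebraMap F R b
  comm : y * x - x * y = y

theorem Polynomial.eq_C_of_comp_X_add_one {F : Type*} [Field F] (p : ℕ) [Fact p.Prime] [CharP F p]
    {f : Polynomial F} (hf : f.natDegree < p) (h : f.comp (X + 1) = f) : f = C (f.eval 0) := by
  have key : ∀ n : ℕ, f.eval (n : F) = f.eval 0 := by
    intro n
    induction n with
    | zero => simp
    | succ k ih =>
      conv_rhs => rw [← ih, ← h]
      simp
  rw [← sub_eq_zero]
  refine eq_zero_of_natDegree_lt_card_of_eval_eq_zero _ (ι := Fin p) (f := fun i => ((i : ℕ) : F))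
    ?_ (fun i => by simp [key]) ?_
  · intro i j hij
    have := CharP.natCast_injOn_Iio F p i.2 j.2 hij
    exact Fin.ext this
  · simpa using hf

namespace IsSymbolPair

open Polynomial

variable {F R : Type*} [Field F] [Ring R] [Algebra F R] {p : ℕ} {a b : F} {x y : R}

theorem y_mul_x (h : IsSymbolPair p a b x y) : y * x = (x + 1) * y := by
  rw [add_mul, one_mul]; exact sub_eq_iff_eq_add'.1 h.comm

theorem map {S : Type*} [Ring S] [Algebra F S] (h : IsSymbolPair p a b x y) (f : R →ₐ[F] S) :
    IsSymbolPair p a b (f x) (f y) where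
  pow_sub := by rw [← map_pow, ← map_sub, h.pow_sub, AlgHom.commutes]
  pow_eq := by rw [← map_pow, h.pow_eq, AlgHom.commutes]
  comm := by rw [← map_mul, ← map_mul, ← map_sub, h.comm]

theorem y_pow_mul_x (h : IsSymbolPair p a b x y) (n : ℕ) : y ^ n * x = (x + n) * y ^ n := by
  induction n with
  | zero => simp
  | succ k ih =>
    rw [pow_succ', mul_assoc, ih, ← mul_assoc, mul_add, h.y_mul_x, (Nat.commute_cast y k).eq]
    push_cast
    noncomm_ring

theorem y_mul_aeval (h : IsSymbolPair p a b x y) (f : F[X]) :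
    y * aeval x f = aeval x (f.comp (X + 1)) * y := by
  induction f using Polynomial.induction_on' with
  | add f g hf hg => simp [mul_add, add_mul, hf, hg]
  | monomial n c =>
    have : y * x ^ n = (x + 1) ^ n * y := by
      induction n with
      | zero => simp
      | succ k ih => rw [pow_succ, ← mul_assoc, ih, mul_assoc, h.y_mul_x, ← mul_assoc, pow_succ]
    simp only [aeval_monomial, monomial_comp, map_mul, aeval_C, map_pow, map_add, aeval_X, map_one]
    rw [← mul_assoc, ← Algebra.commutes, mul_assoc, this, mul_assoc]

theorem isUnit_y [Fact p.Prime] (h : IsSymbolPair p a b x y) (hb : b ≠ 0) : IsUnit y := by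
  have : IsUnit (y ^ p) := by rw [h.pow_eq]; exact (IsUnit.mk0 b hb).map _
  exact (isUnit_pow_iff (Fact.out : p.Prime).ne_zero).1 this

theorem eq_zero_of_aeval_eq_zero [Fact p.Prime] [CharP F p] [Nontrivial R]
    (h : IsSymbolPair p a b x y) (hb : b ≠ 0)
    {f : F[X]} (hf : f.degree < p) (h0 : aeval x f = 0) : f = 0 := by
  by_contra hne
  have hxint : IsIntegral F x := ⟨f * C f.leadingCoeff⁻¹, monic_mul_leadingCoeff_inv hne, by
    rw [← aeval_def, map_mul, h0, zero_mul]⟩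
  set g := minpoly F x with hg
  have hgm : g.Monic := minpoly.monic hxint
  have hgdeg : g.degree < p := (minpoly.degree_le_of_ne_zero F x hne h0).trans_lt hf
  have hgn : g.natDegree < p := (natDegree_lt_iff_degree_lt hgm.ne_zero).2 hgdeg
  have hcm : (g.comp (X + 1)).Monic := by
    simpa using hgm.comp_X_add_C 1
  have hc0 : aeval x (g.comp (X + 1)) = 0 := by
    have h1 := h.y_mul_aeval g
    rw [minpoly.aeval, mul_zero] at h1
    exact (h.isUnit_y hb).mul_left_eq_zero.1 h1.symm
  have hnat : (g.comp (X + 1)).natDegree = g.natDegree := by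
    rw [natDegree_comp]; simp [show (X + 1 : F[X]) = X + C 1 by simp]
  have hcomp : g.comp (X + 1) = g := by
    by_contra hne'
    have hdeg : (g.comp (X + 1) - g).degree < g.degree := by
      refine degree_sub_lt_right ?_ hgm.ne_zero ?_
      · rw [degree_eq_natDegree hcm.ne_zero, hnat, ← degree_eq_natDegree hgm.ne_zero]
      · rw [hcm.leadingCoeff, hgm.leadingCoeff]
    have := minpoly.degree_le_of_ne_zero F x (sub_ne_zero.2 hne')
      (by rw [map_sub, hc0, minpoly.aeval, sub_zero])
    exact absurd hdeg (not_lt.2 this)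
  have hC := eq_C_of_comp_X_add_one p hgn hcomp
  have h1 : g = 1 := by
    refine (Polynomial.Monic.natDegree_eq_zero hgm).1 ?_
    rw [hC, natDegree_C]
  have := minpoly.aeval F x
  rw [← hg, h1, map_one] at this
  exact one_ne_zero this

theorem eq_zero_of_sum_eq_zero [Fact p.Prime] [CharP F p] [Nontrivial R]
    (h : IsSymbolPair p a b x y) (hb : b ≠ 0)
    {f : Fin p → F[X]} (hf : ∀ j, (f j).degree < p)
    (h0 : ∑ j, aeval x (f j) * y ^ (j : ℕ) = 0) (j : Fin p) : f j = 0 := by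
  let ad : Module.End F R := LinearMap.mulLeft F x - LinearMap.mulRight F x
  have hinj : Function.Injective (fun j : Fin p => -((j : ℕ) : F)) := by
    intro i j hij
    exact Fin.ext (CharP.natCast_injOn_Iio F p i.2 j.2 (neg_injective hij))
  have hind := (iSupIndep_iff_finsetSum_eq_zero_imp_eq_zero _).1
    ((Module.End.eigenspaces_iSupIndep ad).comp hinj)
    Finset.univ (fun j => aeval x (f j) * y ^ (j : ℕ)) (by
      intro j _
      have hc : Commute x (aeval x (f j)) := by
        have := Algebra.commute_of_mem_adjoin_self (R := F) (aeval_mem_adjoin_singleton F x (p := f j))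
        exact this
      simp only [Function.comp, Module.End.mem_eigenspace_iff, ad, LinearMap.sub_apply,
        LinearMap.mulLeft_apply, LinearMap.mulRight_apply]
      rw [mul_assoc, h.y_pow_mul_x, ← mul_assoc, ← mul_assoc, mul_add, hc.eq, add_mul,
        sub_add_cancel_left, neg_smul, ← (Nat.cast_commute _ _).eq, mul_assoc, Nat.cast_smul_eq_nsmul,
        nsmul_eq_mul]) h0 j (Finset.mem_univ j)
  refine h.eq_zero_of_aeval_eq_zero hb (hf j) ?_
  exact ((h.isUnit_y hb).pow _).mul_left_eq_zero.1 hind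

theorem linearIndependent [Fact p.Prime] [CharP F p] [Nontrivial R]
    (h : IsSymbolPair p a b x y) (hb : b ≠ 0) :
    LinearIndependent F (fun ij : Fin p × Fin p => x ^ (ij.1 : ℕ) * y ^ (ij.2 : ℕ)) := by
  rw [Fintype.linearIndependent_iff]
  intro g hg ij
  have hdeg : ∀ j : Fin p, (∑ i : Fin p, monomial (i : ℕ) (g (i, j))).degree < p := by
    intro j
    refine (degree_sum_le _ _).trans_lt ?_
    rw [Finset.sup_lt_iff (by exact WithBot.bot_lt_coe _)]
    intro i _
    exact (degree_monomial_le _ _).trans_lt (by exact_mod_cast i.2)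
  have := h.eq_zero_of_sum_eq_zero hb (f := fun j => ∑ i : Fin p, monomial (i : ℕ) (g (i, j)))
    hdeg (by
      rw [← hg, Fintype.sum_prod_type_right]
      refine Finset.sum_congr rfl fun j _ => ?_
      rw [map_sum, Finset.sum_mul]
      refine Finset.sum_congr rfl fun i _ => ?_
      rw [aeval_monomial, ← Algebra.smul_def, smul_mul_assoc]) ij.2
  have h2 := congrArg (fun q => coeff q (ij.1 : ℕ)) this
  simp only [finsetSum_coeff, coeff_monomial, coeff_zero] at h2
  rw [Finset.sum_eq_single ij.1] at h2
  · simpa using h2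
  · intro i _ hi
    rw [if_neg]
    exact fun h => hi (Fin.ext h)
  · simp

end IsSymbolPair

namespace IsSymbolPair

open Polynomial

variable {F R : Type*} [Field F] [Ring R] [Algebra F R] {p : ℕ} {a b : F} {x y : R}

theorem of_twisted {C : Type*} [CommRing C] [Algebra F C] (τ : C →ₐ[F] C) {x f : C}
    (hx : x ^ p - x = algebraMap F C a) (hτx : τ x = x + 1)
    (hf : ∏ i ∈ Finset.range p, τ^[i] f = algebraMap F C b) (hτ : ∀ v, τ^[p] v = v) :
    IsSymbolPair (R := Module.End F C) p a b (LinearMap.mulLeft F x)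
      (LinearMap.mulLeft F f ∘ₗ τ.toLinearMap) where
  pow_sub := by
    ext v
    rw [LinearMap.pow_mulLeft]
    simp only [LinearMap.sub_apply, LinearMap.mulLeft_apply, Module.algebraMap_end_apply]
    rw [← sub_mul, hx, Algebra.smul_def]
  pow_eq := by
    have key : ∀ n v, ((LinearMap.mulLeft F f ∘ₗ τ.toLinearMap : Module.End F C) ^ n) v =
        (∏ i ∈ Finset.range n, τ^[i] f) * τ^[n] v := by
      intro n
      induction n with
      | zero => intro v; simp
      | succ k ih =>
        intro v
        rw [pow_succ, Module.End.mul_apply, ih]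
        simp only [LinearMap.comp_apply, LinearMap.mulLeft_apply, AlgHom.toLinearMap_apply]
        rw [Finset.prod_range_succ, Function.iterate_succ_apply, iterate_map_mul, mul_assoc]
    ext v
    rw [key, hf, hτ, Module.algebraMap_end_apply, Algebra.smul_def]
  comm := by
    ext v
    simp only [LinearMap.sub_apply, Module.End.mul_apply, LinearMap.comp_apply,
      LinearMap.mulLeft_apply, AlgHom.toLinearMap_apply, map_mul, hτx]
    ring

theorem aeval_mul_pow_mem_span {f : F[X]} (hf : f.degree < p) (j : Fin p) :
    aeval x f * y ^ (j : ℕ) ∈ Submodule.span F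
      (Set.range fun ij : Fin p × Fin p => x ^ (ij.1 : ℕ) * y ^ (ij.2 : ℕ)) := by
  by_cases h0 : f = 0
  · simp [h0]
  rw [aeval_eq_sum_range' ((natDegree_lt_iff_degree_lt h0).2 hf), Finset.sum_mul]
  refine Submodule.sum_mem _ fun i hi => ?_
  rw [smul_mul_assoc]
  exact Submodule.smul_mem _ _ (Submodule.subset_span ⟨(⟨i, Finset.mem_range.1 hi⟩, j), rfl⟩)

theorem span_eq_top [Fact p.Prime] (h : IsSymbolPair p a b x y)
    (hgen : Algebra.adjoin F {x, y} = ⊤) : Submodule.span F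
      (Set.range fun ij : Fin p × Fin p => x ^ (ij.1 : ℕ) * y ^ (ij.2 : ℕ)) = ⊤ := by
  set S := Submodule.span F
      (Set.range fun ij : Fin p × Fin p => x ^ (ij.1 : ℕ) * y ^ (ij.2 : ℕ)) with hS
  have hp := (Fact.out : p.Prime)
  have hx : ∀ s ∈ S, x * s ∈ S := by
    intro s hs
    induction hs using Submodule.span_induction with
    | zero => simp
    | add s t _ _ hs ht => rw [mul_add]; exact S.add_mem hs ht
    | smul c s _ hs => rw [mul_smul_comm]; exact S.smul_mem c hs
    | mem s hs =>
      obtain ⟨⟨i, j⟩, rfl⟩ := hs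
      simp only
      rw [← mul_assoc, ← pow_succ']
      rcases Nat.lt_or_ge ((i : ℕ) + 1) p with hi | hi
      · exact Submodule.subset_span ⟨(⟨_, hi⟩, j), rfl⟩
      · have : (i : ℕ) + 1 = p := le_antisymm i.2 hi
        rw [this, sub_eq_iff_eq_add.1 h.pow_sub]
        have := aeval_mul_pow_mem_span (x := x) (y := y) (f := (C a + X : F[X])) (p := p) (by
          rw [add_comm, degree_X_add_C]
          exact_mod_cast hp.one_lt) j
        simpa using this
  have hy : ∀ s ∈ S, y * s ∈ S := by
    intro s hs
    induction hs using Submodule.span_induction with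
    | zero => simp
    | add s t _ _ hs ht => rw [mul_add]; exact S.add_mem hs ht
    | smul c s _ hs => rw [mul_smul_comm]; exact S.smul_mem c hs
    | mem s hs =>
      obtain ⟨⟨i, j⟩, rfl⟩ := hs
      simp only
      have hdeg : ((X + 1 : F[X]) ^ (i : ℕ)).degree < p := by
        have : ((X + 1 : F[X]) ^ (i : ℕ)).degree = (i : ℕ) := by
          rw [degree_pow, ← C_1, degree_X_add_C, nsmul_one]
        rw [this]
        exact_mod_cast i.2
      have h1 : y * (x ^ (i : ℕ) * y ^ (j : ℕ)) = aeval x ((X + 1 : F[X]) ^ (i : ℕ)) *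
          y ^ ((j : ℕ) + 1) := by
        have := h.y_mul_aeval (X ^ (i : ℕ))
        rw [aeval_X_pow, X_pow_comp] at this
        rw [← mul_assoc, this, mul_assoc, ← pow_succ']
      rw [h1]
      rcases Nat.lt_or_ge ((j : ℕ) + 1) p with hj | hj
      · exact aeval_mul_pow_mem_span hdeg ⟨_, hj⟩
      · have : (j : ℕ) + 1 = p := le_antisymm j.2 hj
        rw [this, h.pow_eq, ← Algebra.commutes, ← Algebra.smul_def]
        refine S.smul_mem _ ?_
        simpa using aeval_mul_pow_mem_span (x := x) (y := y) hdeg ⟨0, hp.pos⟩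
  have hmul : ∀ r : R, ∀ s ∈ S, r * s ∈ S := by
    intro r
    have hr : r ∈ Algebra.adjoin F {x, y} := by rw [hgen]; trivial
    induction hr using Algebra.adjoin_induction with
    | mem r hr =>
      rcases hr with rfl | hr
      · exact hx
      · rw [Set.mem_singleton_iff.1 hr]; exact hy
    | algebraMap c => intro s hs; rw [← Algebra.smul_def]; exact S.smul_mem c hs
    | add r t _ _ hr ht => intro s hs; rw [add_mul]; exact S.add_mem (hr s hs) (ht s hs)
    | mul r t _ _ hr ht => intro s hs; rw [mul_assoc]; exact hr _ (ht s hs)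
  have h1 : (1 : R) ∈ S := Submodule.subset_span ⟨(⟨0, hp.pos⟩, ⟨0, hp.pos⟩), by simp⟩
  exact eq_top_iff.2 fun r _ => by simpa using hmul r 1 h1

/-- The monomial basis of a nontrivial algebra generated by a symbol pair. -/
noncomputable def basis [Fact p.Prime] [CharP F p] [Nontrivial R] (h : IsSymbolPair p a b x y)
    (hb : b ≠ 0) (hgen : Algebra.adjoin F {x, y} = ⊤) : Module.Basis (Fin p × Fin p) F R :=
  Module.Basis.mk (h.linearIndependent hb) (h.span_eq_top hgen).ge

theorem exists_eq_sum [Fact p.Prime] (h : IsSymbolPair p a b x y)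
    (hgen : Algebra.adjoin F {x, y} = ⊤) (r : R) :
    ∃ f : Fin p → F[X], (∀ j, (f j).degree < p) ∧ r = ∑ j, aeval x (f j) * y ^ (j : ℕ) := by
  have hr : r ∈ Submodule.span F
      (Set.range fun ij : Fin p × Fin p => x ^ (ij.1 : ℕ) * y ^ (ij.2 : ℕ)) := by
    rw [h.span_eq_top hgen]; trivial
  obtain ⟨c, rfl⟩ := (Submodule.mem_span_range_iff_exists_fun F).1 hr
  refine ⟨fun j => ∑ i : Fin p, monomial (i : ℕ) (c (i, j)), fun j => ?_, ?_⟩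
  · refine (degree_sum_le _ _).trans_lt ?_
    rw [Finset.sup_lt_iff (by exact WithBot.bot_lt_coe _)]
    intro i _
    exact (degree_monomial_le _ _).trans_lt (by exact_mod_cast i.2)
  · rw [Fintype.sum_prod_type_right]
    refine Finset.sum_congr rfl fun j _ => ?_
    rw [map_sum, Finset.sum_mul]
    refine Finset.sum_congr rfl fun i _ => ?_
    rw [aeval_monomial, ← Algebra.smul_def, smul_mul_assoc]

theorem isCentral [Fact p.Prime] [CharP F p] [Nontrivial R] (h : IsSymbolPair p a b x y)
    (hb : b ≠ 0) (hgen : Algebra.adjoin F {x, y} = ⊤) : Algebra.IsCentral F R where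
  out := by
    intro z hz
    have hp := (Fact.out : p.Prime)
    rw [Subalgebra.mem_center_iff] at hz
    obtain ⟨f, hf, rfl⟩ := h.exists_eq_sum hgen z
    have hcx : ∀ g : F[X], Commute x (aeval x g) := fun g =>
      Algebra.commute_of_mem_adjoin_self (R := F) (aeval_mem_adjoin_singleton F x (p := g))
    have h1 : ∑ j : Fin p, aeval x ((C ((j : ℕ) : F)) * f j) * y ^ (j : ℕ) = 0 := by
      have := hz x
      rw [eq_comm, ← sub_eq_zero, Finset.mul_sum, Finset.sum_mul, ← Finset.sum_sub_distrib] at this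
      rw [← this]
      refine Finset.sum_congr rfl fun j _ => ?_
      rw [mul_assoc _ _ x, h.y_pow_mul_x, ← mul_assoc x, (hcx _).eq, ← mul_assoc, ← sub_mul, mul_add,
        add_sub_cancel_left, map_mul, aeval_C, Algebra.commutes]
      simp
    have h2 : ∀ j : Fin p, (j : ℕ) ≠ 0 → f j = 0 := by
      intro j hj
      have := h.eq_zero_of_sum_eq_zero hb (fun j => by
        rw [← smul_eq_C_mul]; exact (degree_smul_le _ _).trans_lt (hf j)) h1 j
      rcases mul_eq_zero.1 this with h0 | h0
      · rw [C_eq_zero, CharP.cast_eq_zero_iff F p] at h0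
        exact absurd (Nat.le_of_dvd (Nat.pos_of_ne_zero hj) h0) (not_le.2 j.2)
      · exact h0
    have h3 : ∑ j, aeval x (f j) * y ^ (j : ℕ) = aeval x (f ⟨0, hp.pos⟩) := by
      rw [Finset.sum_eq_single ⟨0, hp.pos⟩]
      · simp
      · intro j _ hj
        rw [h2 j (fun h => hj (Fin.ext h)), map_zero, zero_mul]
      · simp
    rw [h3] at hz ⊢
    set g := f ⟨0, hp.pos⟩ with hg
    have h4 : aeval x (g.comp (X + 1) - g) = 0 := by
      have := hz y
      rw [h.y_mul_aeval] at this
      rw [map_sub, sub_eq_zero]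
      exact (h.isUnit_y hb).mul_right_cancel this
    by_cases hg0 : g = 0
    · rw [hg0, map_zero]; exact zero_mem _
    have hgn : g.natDegree < p := (natDegree_lt_iff_degree_lt hg0).2 (hf _)
    have hcn : (g.comp (X + 1)).natDegree < p := by
      rw [natDegree_comp]; simpa [show (X + 1 : F[X]) = X + C 1 by simp] using hgn
    have hlt : (g.comp (X + 1) - g).degree < p := by
      refine (degree_sub_le _ _).trans_lt (max_lt ?_ (hf _))
      exact degree_le_natDegree.trans_lt (by exact_mod_cast hcn)
    have h5 := h.eq_zero_of_aeval_eq_zero hb hlt h4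
    rw [eq_C_of_comp_X_add_one p hgn (sub_eq_zero.1 h5), aeval_C]
    exact ⟨_, rfl⟩

theorem isSimpleRing [Fact p.Prime] [CharP F p] [Nontrivial R] (h : IsSymbolPair p a b x y)
    (hb : b ≠ 0) (hgen : Algebra.adjoin F {x, y} = ⊤) : IsSimpleRing R := by
  rw [isSimpleRing_iff_isTwoSided_imp]
  refine ⟨inferInstance, fun I hI => ?_⟩
  by_cases hI' : I = ⊤
  · exact Or.inr hI'
  left
  have : Nontrivial (R ⧸ I) := Ideal.Quotient.nontrivial_iff.2 hI'
  let q := Ideal.Quotient.mkₐ F I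
  rw [eq_bot_iff]
  intro r hr
  obtain ⟨f, hf, rfl⟩ := h.exists_eq_sum hgen r
  have h0 : q (∑ j, aeval x (f j) * y ^ (j : ℕ)) = 0 := Ideal.Quotient.eq_zero_iff_mem.2 hr
  have h1 : ∑ j, aeval (q x) (f j) * q y ^ (j : ℕ) = 0 := by
    rw [← h0, map_sum]
    refine Finset.sum_congr rfl fun j _ => ?_
    rw [map_mul, map_pow, aeval_algHom_apply]
  have := (h.map q).eq_zero_of_sum_eq_zero hb hf h1
  simp [this]

end IsSymbolPair

namespace SymbolAlg

variable {F : Type} [Field F] (p : ℕ) (a b : F)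

/-- The generator `x` of `[a,b)`. -/
def X : SymbolAlg F p a b := RingQuot.mkAlgHom F (SymbolRel F p a b) (FreeAlgebra.ι F 0)

/-- The generator `y` of `[a,b)`. -/
def Y : SymbolAlg F p a b := RingQuot.mkAlgHom F (SymbolRel F p a b) (FreeAlgebra.ι F 1)

theorem isSymbolPair : IsSymbolPair p a b (X p a b) (Y p a b) where
  pow_sub := by
    have := RingQuot.mkAlgHom_rel F (SymbolRel.x (p := p) (a := a) (b := b))
    simpa [X] using this
  pow_eq := by
    have := RingQuot.mkAlgHom_rel F (SymbolRel.y (p := p) (a := a) (b := b))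
    simpa [Y] using this
  comm := by
    have := RingQuot.mkAlgHom_rel F (SymbolRel.comm (p := p) (a := a) (b := b))
    simpa [X, Y] using this

theorem adjoin_eq_top : Algebra.adjoin F {X p a b, Y p a b} = ⊤ := by
  have h1 := congrArg (Subalgebra.map (RingQuot.mkAlgHom F (SymbolRel F p a b)))
    (FreeAlgebra.adjoin_range_ι F (Fin 2))
  rw [AlgHom.map_adjoin, Algebra.map_top,
    (AlgHom.range_eq_top _).2 (RingQuot.mkAlgHom_surjective F _), ← Set.range_comp] at h1
  rw [← h1]
  congr 1
  ext z
  simp [X, Y, Fin.exists_fin_two, eq_comm]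

variable {p a b}

/-- The homomorphism out of `[a,b)` determined by a symbol pair. -/
noncomputable def lift {R : Type*} [Ring R] [Algebra F R] {x y : R} (h : IsSymbolPair p a b x y) :
    SymbolAlg F p a b →ₐ[F] R :=
  RingQuot.liftAlgHom F ⟨FreeAlgebra.lift F ![x, y], by
    intro u v huv
    cases huv with
    | x => simpa using h.pow_sub
    | y => simpa using h.pow_eq
    | comm => simpa using h.comm⟩

theorem lift_X {R : Type*} [Ring R] [Algebra F R] {x y : R} (h : IsSymbolPair p a b x y) :
    lift h (X p a b) = x := by
  simp [lift, X, RingQuot.liftAlgHom_mkAlgHom_apply]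

theorem lift_Y {R : Type*} [Ring R] [Algebra F R] {x y : R} (h : IsSymbolPair p a b x y) :
    lift h (Y p a b) = y := by
  simp [lift, Y, RingQuot.liftAlgHom_mkAlgHom_apply]

theorem isSymbolPair_shift [Fact p.Prime] [CharP F p] {K : Type*} [Field K] [Algebra F K]
    {u : K} (hu : u ^ p - u = algebraMap F K a) {g : ZMod p → K}
    (hg : ∏ i, g i = algebraMap F K b) :
    ∃ x y : Module.End F (ZMod p → K), IsSymbolPair p a b x y := by
  have : CharP K p := charP_of_injective_algebraMap (algebraMap F K).injective p
  let τ : (ZMod p → K) →ₐ[F] (ZMod p → K) := 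
    AlgHom.pi fun i => Pi.evalAlgHom F (fun _ : ZMod p => K) (i + 1)
  have hτ : ∀ (n : ℕ) (v : ZMod p → K) (i : ZMod p), τ^[n] v i = v (i + n) := by
    intro n
    induction n with
    | zero => simp
    | succ k ih =>
      intro v i
      rw [Function.iterate_succ_apply, ih]
      simp [τ, add_assoc]
  refine ⟨_, _, IsSymbolPair.of_twisted (C := ZMod p → K) τ
    (x := fun i => u + ZMod.castHom (dvd_refl p) K i) (f := g) ?_ ?_ ?_ ?_⟩
  · ext i
    simp only [Pi.sub_apply, Pi.pow_apply, Pi.algebraMap_apply]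
    rw [add_pow_char, ← hu, ← map_pow, ZMod.pow_card]
    ring
  · ext i
    simp [τ, add_assoc]
  · ext i
    rw [Finset.prod_apply, Pi.algebraMap_apply, ← hg]
    simp only [hτ]
    rw [Finset.prod_range fun n => g (i + n)]
    refine Fintype.prod_bijective (fun n : Fin p => i + ((n : ℕ) : ZMod p)) ?_ _ _ (fun _ => rfl)
    rw [Fintype.bijective_iff_injective_and_card]
    refine ⟨fun m n hmn => Fin.ext ?_, by simp [ZMod.card]⟩
    exact CharP.natCast_injOn_Iio (ZMod p) p m.2 n.2 (add_left_cancel hmn)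
  · intro v
    ext i
    simp [hτ]

variable [Fact p.Prime] [CharP F p]

theorem nontrivial : Nontrivial (SymbolAlg F p a b) := by
  have hp := (Fact.out : p.Prime)
  let K := AlgebraicClosure F
  obtain ⟨u, hu⟩ : ∃ u : K, u ^ p - u = algebraMap F K a := by
    have hdeg : (Polynomial.X ^ p - (Polynomial.X + Polynomial.C (algebraMap F K a))).degree =
        (p : WithBot ℕ) := by
      rw [Polynomial.degree_sub_eq_left_of_degree_lt]
      · simp
      · rw [Polynomial.degree_X_add_C, Polynomial.degree_X_pow]
        exact_mod_cast hp.one_lt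
    obtain ⟨u, hu⟩ := IsAlgClosed.exists_root _ (by rw [hdeg]; exact_mod_cast hp.ne_zero)
    exact ⟨u, by simpa [sub_eq_zero, sub_eq_iff_eq_add'] using hu⟩
  obtain ⟨c, hc⟩ := IsAlgClosed.exists_pow_nat_eq (algebraMap F K b) hp.pos
  obtain ⟨x, y, hxy⟩ := isSymbolPair_shift (p := p) (b := b) hu (g := fun _ => c)
    (by simpa [ZMod.card] using hc)
  exact (lift hxy).toRingHom.domain_nontrivial

theorem isSimpleRing (hb : b ≠ 0) : IsSimpleRing (SymbolAlg F p a b) :=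
  have := nontrivial (p := p) (a := a) (b := b)
  (isSymbolPair p a b).isSimpleRing hb (adjoin_eq_top p a b)

theorem isCentral (hb : b ≠ 0) : Algebra.IsCentral F (SymbolAlg F p a b) :=
  have := nontrivial (p := p) (a := a) (b := b)
  (isSymbolPair p a b).isCentral hb (adjoin_eq_top p a b)

theorem finiteDimensional (hb : b ≠ 0) : FiniteDimensional F (SymbolAlg F p a b) :=
  have := nontrivial (p := p) (a := a) (b := b)
  Module.Finite.of_basis ((isSymbolPair p a b).basis hb (adjoin_eq_top p a b))

theorem finrank_eq (hb : b ≠ 0) : Module.finrank F (SymbolAlg F p a b) = p ^ 2 := by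
  have := nontrivial (p := p) (a := a) (b := b)
  rw [Module.finrank_eq_card_basis ((isSymbolPair p a b).basis hb (adjoin_eq_top p a b))]
  simp [sq]

end SymbolAlg

namespace Algebra.TensorProduct

variable {F A B ι : Type*} [Field F] [Ring A] [Ring B] [Algebra F A] [Algebra F B]

theorem basis_repr_tmul_one_mul (e : Module.Basis ι F B) (a : A) (z : A ⊗[F] B) (i : ι) :
    (basis A e).repr ((a ⊗ₜ 1) * z) i = a * (basis A e).repr z i := by
  induction z using TensorProduct.induction_on with
  | zero => simp
  | add z w hz hw => rw [mul_add, map_add, map_add, Finsupp.add_apply, hz, hw, Finsupp.add_apply,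
      mul_add]
  | tmul c b => simp [basis_repr_tmul, mul_assoc]

theorem basis_repr_mul_tmul_one (e : Module.Basis ι F B) (a : A) (z : A ⊗[F] B) (i : ι) :
    (basis A e).repr (z * (a ⊗ₜ 1)) i = (basis A e).repr z i * a := by
  induction z using TensorProduct.induction_on with
  | zero => simp
  | add z w hz hw => rw [add_mul, map_add, map_add, Finsupp.add_apply, hz, hw, Finsupp.add_apply,
      add_mul]
  | tmul c b => simp [basis_repr_tmul, mul_assoc, ← Algebra.commutes]

theorem exists_eq_one_tmul [Algebra.IsCentral F A] {z : A ⊗[F] B}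
    (hz : ∀ a : A, (a ⊗ₜ 1) * z = z * (a ⊗ₜ 1)) : ∃ b : B, z = 1 ⊗ₜ b := by
  let e := Module.Basis.ofVectorSpace F B
  have h : ∀ i, ∃ c : F, algebraMap F A c = (basis A e).repr z i := by
    intro i
    have : (basis A e).repr z i ∈ Subalgebra.center F A := by
      rw [Subalgebra.mem_center_iff]
      intro a
      rw [← basis_repr_tmul_one_mul, hz, basis_repr_mul_tmul_one]
    exact Algebra.mem_bot.1 (Algebra.IsCentral.out this)
  choose c hc using h
  refine ⟨((basis A e).repr z).sum fun i _ => c i • e i, ?_⟩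
  conv_lhs => rw [← (basis A e).linearCombination_repr z]
  rw [Finsupp.linearCombination_apply, Finsupp.sum, Finsupp.sum, TensorProduct.tmul_sum]
  refine Finset.sum_congr rfl fun i _ => ?_
  rw [← hc, basis_apply, TensorProduct.tmul_smul, algebraMap_smul]

theorem isCentral_of_field [Algebra.IsCentral F A] [Algebra.IsCentral F B] [Nontrivial A] :
    Algebra.IsCentral F (A ⊗[F] B) where
  out := by
    intro z hz
    rw [Subalgebra.mem_center_iff] at hz
    obtain ⟨b, rfl⟩ := exists_eq_one_tmul fun a => hz (a ⊗ₜ 1)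
    have hb : b ∈ Subalgebra.center F B := by
      rw [Subalgebra.mem_center_iff]
      intro b'
      have := hz (1 ⊗ₜ b')
      rw [tmul_mul_tmul, tmul_mul_tmul, one_mul] at this
      exact includeRight_injective (R := F) (A := A) (B := B) (algebraMap F A).injective this
    obtain ⟨c, rfl⟩ := Algebra.mem_bot.1 (Algebra.IsCentral.out hb)
    exact ⟨c, by simp [Algebra.algebraMap_eq_smul_one, one_def]⟩

theorem isSimpleRing_of_isCentral [Algebra.IsCentral F A] [IsSimpleRing A] [IsSimpleRing B] :
    IsSimpleRing (A ⊗[F] B) := by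
  rw [isSimpleRing_iff_isTwoSided_imp]
  refine ⟨inferInstance, fun I hI => or_iff_not_imp_left.2 fun hI0 => ?_⟩
  have hsA := (isSimpleRing_iff_isTwoSided_imp.1 ‹IsSimpleRing A›).2
  have hsB := (isSimpleRing_iff_isTwoSided_imp.1 ‹IsSimpleRing B›).2
  let e := Module.Basis.ofVectorSpace F B
  let r := fun z : A ⊗[F] B => (basis A e).repr z
  have hex : ∃ n : ℕ, ∃ z ∈ I, z ≠ 0 ∧ (r z).support.card = n := by
    obtain ⟨z, hz, hz0⟩ := Submodule.exists_mem_ne_zero_of_ne_bot hI0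
    exact ⟨_, z, hz, hz0, rfl⟩
  classical
  obtain ⟨z, hz, hz0, hzc⟩ := Nat.find_spec hex
  have hmin : ∀ w ∈ I, (r w).support.card < (r z).support.card → w = 0 := by
    intro w hw hlt
    by_contra hw0
    rw [hzc] at hlt
    exact Nat.find_min hex hlt ⟨w, hw, hw0, rfl⟩
  obtain ⟨i, hi⟩ : (r z).support.Nonempty := by
    rw [Finsupp.support_nonempty_iff]
    exact fun h => hz0 ((basis A e).repr.map_eq_zero_iff.1 h)
  let J : Ideal A :=
    { carrier := {c | ∃ w ∈ I, (r w).support ⊆ (r z).support ∧ r w i = c}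
      zero_mem' := ⟨0, I.zero_mem, by simp [r], by simp [r]⟩
      add_mem' := by
        rintro _ _ ⟨w, hw, hws, rfl⟩ ⟨w', hw', hws', rfl⟩
        refine ⟨w + w', I.add_mem hw hw', ?_, by simp [r]⟩
        simp only [r, map_add]
        exact Finsupp.support_add.trans (Finset.union_subset hws hws')
      smul_mem' := by
        rintro a _ ⟨w, hw, hws, rfl⟩
        refine ⟨(a ⊗ₜ 1) * w, I.mul_mem_left _ hw, ?_, basis_repr_tmul_one_mul _ _ _ _⟩
        refine subset_trans (fun j hj => ?_) hws
        rw [Finsupp.mem_support_iff] at hj ⊢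
        contrapose! hj
        simp only [r] at hj ⊢
        rw [basis_repr_tmul_one_mul, hj, mul_zero] }
  have hJ : J.IsTwoSided := ⟨by
    rintro _ a ⟨w, hw, hws, rfl⟩
    refine ⟨w * (a ⊗ₜ 1), I.mul_mem_right _ hw, ?_, basis_repr_mul_tmul_one _ _ _ _⟩
    refine subset_trans (fun j hj => ?_) hws
    rw [Finsupp.mem_support_iff] at hj ⊢
    contrapose! hj
    simp only [r] at hj ⊢
    rw [basis_repr_mul_tmul_one, hj, zero_mul]⟩
  have hJtop : J = ⊤ := by
    refine (hsA J hJ).resolve_left fun hbot => ?_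
    have : r z i ∈ J := ⟨z, hz, subset_rfl, rfl⟩
    rw [hbot] at this
    exact Finsupp.mem_support_iff.1 hi this
  obtain ⟨w, hw, hws, hw1⟩ : (1 : A) ∈ J := by rw [hJtop]; trivial
  have hcomm : ∀ a : A, (a ⊗ₜ 1) * w = w * (a ⊗ₜ 1) := by
    intro a
    rw [← sub_eq_zero]
    refine hmin _ (I.sub_mem (I.mul_mem_left _ hw) (I.mul_mem_right _ hw)) ?_
    refine Finset.card_lt_card (Finset.ssubset_iff_subset_ne.2 ⟨fun j hj => hws ?_, fun h => ?_⟩)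
    · rw [Finsupp.mem_support_iff] at hj ⊢
      contrapose! hj
      simp only [r, map_sub, Finsupp.sub_apply] at hj ⊢
      rw [basis_repr_mul_tmul_one, basis_repr_tmul_one_mul, hj, zero_mul, mul_zero, sub_zero]
    · rw [← h, Finsupp.mem_support_iff] at hi
      apply hi
      simp only [r, map_sub, Finsupp.sub_apply] at hw1 ⊢
      rw [basis_repr_mul_tmul_one, basis_repr_tmul_one_mul, hw1, one_mul, mul_one, sub_self]
  obtain ⟨b, rfl⟩ := exists_eq_one_tmul hcomm
  have hb0 : b ≠ 0 := by
    rintro rfl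
    simp [r] at hw1
  let J' : Ideal B := I.comap (includeRight : B →ₐ[F] A ⊗[F] B)
  have hJ' : J'.IsTwoSided := ⟨by
    intro b c hb
    simp only [J', Ideal.mem_comap, map_mul] at hb ⊢
    exact I.mul_mem_right _ hb⟩
  have : (1 : B) ∈ J' := by
    rw [(hsB J' hJ').resolve_left fun hbot => hb0 ?_]
    · trivial
    · have : b ∈ J' := hw
      rwa [hbot] at this
  rw [Ideal.eq_top_iff_one]
  simpa [J', one_def] using this

end Algebra.TensorProduct

namespace PiTensorProduct

/-- Splitting off the first factor of a finite tensor product of algebras. -/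
noncomputable def succAlgEquiv {F : Type*} [Field F] {n : ℕ} (S : Fin (n + 1) → Type*)
    [∀ i, Ring (S i)] [∀ i, Algebra F (S i)] :
    (⨂[F] i, S i) ≃ₐ[F] S 0 ⊗[F] (⨂[F] i : Fin n, S i.succ) := by
  let f : MultilinearMap F S (S 0 ⊗[F] (⨂[F] i : Fin n, S i.succ)) :=
    LinearMap.uncurryLeft
      { toFun := fun s => (TensorProduct.mk F (S 0) (⨂[F] i : Fin n, S i.succ) s).compMultilinearMap
          (tprod F)
        map_add' := fun s t => by ext; simp
        map_smul' := fun c s => by ext; simp [TensorProduct.smul_tmul'] }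
  have hf : ∀ v, f v = v 0 ⊗ₜ tprod F (fun i : Fin n => v i.succ) := fun v => rfl
  let g : S 0 ⊗[F] (⨂[F] i : Fin n, S i.succ) →ₗ[F] ⨂[F] i, S i :=
    TensorProduct.lift ((PiTensorProduct.lift (R := F)).toLinearMap ∘ₗ (tprod F (s := S)).curryLeft)
  have hg : ∀ s v, g (s ⊗ₜ tprod F v) = tprod F (Fin.cons s v) := fun s v => by
    simp [g]
  refine AlgEquiv.ofLinearEquiv (LinearEquiv.ofLinearMap (PiTensorProduct.lift f) g ?_ ?_) ?_ ?_
  · ext s v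
    simp [hf, hg]
  · ext v
    simp only [LinearMap.compMultilinearMap_apply, LinearMap.comp_apply, lift.tprod, hf, hg,
      LinearMap.id_apply]
    congr 1
    exact Fin.cons_self_tail v
  · change PiTensorProduct.lift f 1 = 1
    rw [one_def, lift.tprod, hf]
    rfl
  · intro x y
    change PiTensorProduct.lift f _ = PiTensorProduct.lift f _ * PiTensorProduct.lift f _
    induction x using PiTensorProduct.induction_on with
    | add x x' hx hx' => rw [add_mul, map_add, hx, hx', map_add, add_mul]
    | smul_tprod c v =>
      induction y using PiTensorProduct.induction_on with
      | add x x' hx hx' => rw [mul_add, map_add, hx, hx', map_add, mul_add]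
      | smul_tprod d w =>
        rw [smul_mul_smul_comm, map_smul, map_smul, map_smul, smul_mul_smul_comm, tprod_mul_tprod,
          lift.tprod, lift.tprod, lift.tprod, hf, hf, hf, Algebra.TensorProduct.tmul_mul_tmul,
          tprod_mul_tprod]
        rfl

/-- The empty tensor product of algebras is the base field. -/
noncomputable def isEmptyAlgEquiv {F ι : Type*} [Field F] [IsEmpty ι] (S : ι → Type*)
    [∀ i, Ring (S i)] [∀ i, Algebra F (S i)] : (⨂[F] i, S i) ≃ₐ[F] F := by
  have h1 : ∀ f : Π i, S i, isEmptyEquiv (R := F) ι (tprod F f) = 1 := isEmptyEquiv_apply_tprod _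
  refine AlgEquiv.ofLinearEquiv (isEmptyEquiv (R := F) ι) (h1 _) ?_
  intro x y
  induction x using PiTensorProduct.induction_on with
  | add x x' hx hx' => rw [add_mul, map_add, hx, hx', map_add, add_mul]
  | smul_tprod c v =>
    induction y using PiTensorProduct.induction_on with
    | add x x' hx hx' => rw [mul_add, map_add, hx, hx', map_add, mul_add]
    | smul_tprod d w =>
      rw [smul_mul_smul_comm, map_smul, map_smul, map_smul, tprod_mul_tprod, h1, h1, h1]
      simp

end PiTensorProduct

namespace BrauerEquiv

variable {F A B C D : Type} [Field F] [Ring A] [Ring B] [Ring C] [Ring D]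
  [Algebra F A] [Algebra F B] [Algebra F C] [Algebra F D]

theorem of_matrix {ι κ : Type*} [Fintype ι] [Fintype κ] [DecidableEq ι] [DecidableEq κ]
    [Nonempty ι] [Nonempty κ] (e : Matrix ι ι A ≃ₐ[F] Matrix κ κ B) : BrauerEquiv F A B :=
  ⟨Fintype.card ι, Fintype.card κ, Fintype.card_pos, Fintype.card_pos,
    ⟨(Matrix.reindexAlgEquiv F A (Fintype.equivFin ι)).symm.trans
      (e.trans (Matrix.reindexAlgEquiv F B (Fintype.equivFin κ)))⟩⟩

theorem of_algEquiv (e : A ≃ₐ[F] B) : BrauerEquiv F A B :=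
  of_matrix (ι := Unit) (κ := Unit) e.mapMatrix

theorem symm (h : BrauerEquiv F A B) : BrauerEquiv F B A := by
  obtain ⟨n, m, hn, hm, ⟨e⟩⟩ := h
  exact ⟨m, n, hm, hn, ⟨e.symm⟩⟩

theorem trans (h : BrauerEquiv F A B) (h' : BrauerEquiv F B C) : BrauerEquiv F A C := by
  obtain ⟨n, m, hn, hm, ⟨e⟩⟩ := h
  obtain ⟨k, l, hk, hl, ⟨e'⟩⟩ := h'
  have := Fin.pos_iff_nonempty.1 hn
  have := Fin.pos_iff_nonempty.1 hm
  have := Fin.pos_iff_nonempty.1 hk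
  have := Fin.pos_iff_nonempty.1 hl
  exact of_matrix ((Matrix.compAlgEquiv (Fin k) (Fin n) A F).symm.trans <| e.mapMatrix.trans <|
    (Matrix.compAlgEquiv _ _ _ _).trans <|
    (Matrix.reindexAlgEquiv F B (.prodComm _ _)).trans <| (Matrix.compAlgEquiv _ _ _ _).symm.trans <|
    e'.mapMatrix.trans <| (Matrix.compAlgEquiv _ _ _ _))

theorem tensor (h : BrauerEquiv F A B) (h' : BrauerEquiv F C D) :
    BrauerEquiv F (A ⊗[F] C) (B ⊗[F] D) := by
  obtain ⟨n, m, hn, hm, ⟨e⟩⟩ := h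
  obtain ⟨k, l, hk, hl, ⟨e'⟩⟩ := h'
  have := Fin.pos_iff_nonempty.1 hn
  have := Fin.pos_iff_nonempty.1 hm
  have := Fin.pos_iff_nonempty.1 hk
  have := Fin.pos_iff_nonempty.1 hl
  exact of_matrix ((Matrix.kroneckerTMulAlgEquiv (Fin n) (Fin k) F F A C).symm.trans <|
    (Algebra.TensorProduct.congr e e').trans <|
    Matrix.kroneckerTMulAlgEquiv (Fin m) (Fin l) F F B D)

theorem matrix {ι : Type} [Fintype ι] [DecidableEq ι] [Nonempty ι] :
    BrauerEquiv F (Matrix ι ι A) A :=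
  of_matrix (ι := Unit) (Matrix.compAlgEquiv Unit ι A F)

end BrauerEquiv

/-- Brauer equivalence as a setoid on `F`-algebras. -/
def brauerSetoid (F : Type) [Field F] : Setoid (AlgCat.{0} F) where
  r A B := BrauerEquiv F A B
  iseqv := ⟨fun _ => .of_algEquiv .refl, .symm, .trans⟩

/-- The commutative monoid of `F`-algebras up to Brauer equivalence. -/
def BrauerMonoid (F : Type) [Field F] : Type 1 := Quotient (brauerSetoid F)

namespace BrauerMonoid

variable {F : Type} [Field F]

/-- The class of an `F`-algebra. -/
def mk (F : Type) [Field F] (A : Type) [Ring A] [Algebra F A] : BrauerMonoid F :=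
  Quotient.mk (brauerSetoid F) (AlgCat.of F A)

theorem mk_eq_mk {A B : Type} [Ring A] [Ring B] [Algebra F A] [Algebra F B] :
    mk F A = mk F B ↔ BrauerEquiv F A B :=
  Quotient.eq (r := brauerSetoid F)

theorem mk_eq_of_algEquiv {A B : Type} [Ring A] [Ring B] [Algebra F A] [Algebra F B]
    (e : A ≃ₐ[F] B) : mk F A = mk F B := mk_eq_mk.2 (.of_algEquiv e)

theorem mk_matrix {A ι : Type} [Ring A] [Algebra F A] [Fintype ι] [DecidableEq ι] [Nonempty ι] :
    mk F (Matrix ι ι A) = mk F A := mk_eq_mk.2 .matrix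

noncomputable instance : CommMonoid (BrauerMonoid F) where
  mul := Quotient.map₂ (fun A B => AlgCat.of F (A ⊗[F] B)) fun _ _ h _ _ h' => .tensor h h'
  one := mk F F
  mul_assoc := by
    rintro ⟨A⟩ ⟨B⟩ ⟨C⟩
    exact mk_eq_of_algEquiv (Algebra.TensorProduct.assoc F F F A B C)
  one_mul := by
    rintro ⟨A⟩
    exact mk_eq_of_algEquiv (Algebra.TensorProduct.lid F A)
  mul_one := by
    rintro ⟨A⟩
    exact mk_eq_of_algEquiv (Algebra.TensorProduct.rid F F A)
  mul_comm := by
    rintro ⟨A⟩ ⟨B⟩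
    exact mk_eq_of_algEquiv (Algebra.TensorProduct.comm F A B)


theorem mk_tensor {A B : Type} [Ring A] [Ring B] [Algebra F A] [Algebra F B] :
    mk F (A ⊗[F] B) = mk F A * mk F B := rfl

theorem mk_piTensorProduct {n : ℕ} (S : Fin n → Type) [∀ i, Ring (S i)] [∀ i, Algebra F (S i)] :
    mk F (⨂[F] i, S i) = ∏ i, mk F (S i) := by
  induction n with
  | zero =>
    rw [Fin.prod_univ_zero]
    exact mk_eq_of_algEquiv (PiTensorProduct.isEmptyAlgEquiv S)
  | succ n ih =>
    rw [Fin.prod_univ_succ, ← ih, ← mk_tensor]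
    exact mk_eq_of_algEquiv (PiTensorProduct.succAlgEquiv S)

theorem mk_end {V : Type} [AddCommGroup V] [Module F V] [FiniteDimensional F V] [Nontrivial V] :
    mk F (Module.End F V) = 1 := by
  have : Nonempty (Fin (Module.finrank F V)) := Fin.pos_iff_nonempty.1 Module.finrank_pos
  rw [mk_eq_of_algEquiv (algEquivMatrix (Module.finBasis F V)), mk_matrix]
  rfl

theorem mk_eq_one_of_algHom {A V : Type} [Ring A] [Algebra F A] [IsSimpleRing A]
    [AddCommGroup V] [Module F V] [FiniteDimensional F V] [FiniteDimensional F A] [Nontrivial V]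
    (f : A →ₐ[F] Module.End F V) (h : Module.finrank F A = Module.finrank F V ^ 2) :
    mk F A = 1 := by
  have hinj : Function.Injective f := f.toRingHom.injective
  have hbij : Function.Bijective f := ⟨hinj, by
    refine (LinearMap.injective_iff_surjective_of_finrank_eq_finrank (f := f.toLinearMap) ?_).1 hinj
    rw [h, Module.finrank_linearMap, sq]⟩
  rw [mk_eq_of_algEquiv (AlgEquiv.ofBijective f hbij), mk_end]

theorem mk_eq_mk_of_algHom {A B : Type} [Ring A] [Algebra F A] [IsSimpleRing A] [Ring B]
    [Algebra F B] [FiniteDimensional F A] [FiniteDimensional F B] [Nontrivial B]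
    (f : A →ₐ[F] B) (h : Module.finrank F A = Module.finrank F B) : mk F A = mk F B := by
  have hinj : Function.Injective f := f.toRingHom.injective
  exact mk_eq_of_algEquiv (AlgEquiv.ofBijective f ⟨hinj,
    (LinearMap.injective_iff_surjective_of_finrank_eq_finrank (f := f.toLinearMap) h).1 hinj⟩)

end BrauerMonoid

namespace IsSymbolPair

variable {F R : Type*} [Field F] [Ring R] [Algebra F R] {p : ℕ} {a b : F} {x y : R}

theorem add_left [Fact p.Prime] [CharP R p] (h : IsSymbolPair p a b x y) {a' : F} {x' : R}
    (h' : x' ^ p - x' = algebraMap F R a') (hx : Commute x x') (hy : Commute y x') :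
    IsSymbolPair p (a + a') b (x + x') y where
  pow_sub := by
    rw [add_pow_char_of_commute _ hx, map_add, ← h', ← h.pow_sub]
    abel
  pow_eq := h.pow_eq
  comm := by
    rw [mul_add, add_mul, hy.eq, add_sub_add_right_eq_sub, h.comm]

theorem mul_right (h : IsSymbolPair p a b x y) {c : F} {z : R}
    (hz : z ^ p = algebraMap F R c) (hx : Commute x z) (hy : Commute y z) :
    IsSymbolPair p a (b * c) x (y * z) where
  pow_sub := h.pow_sub
  pow_eq := by rw [hy.mul_pow, h.pow_eq, hz, map_mul]
  comm := by rw [mul_assoc, ← hx.eq, ← mul_assoc, ← mul_assoc, ← sub_mul, h.comm]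

theorem pow_sub_neg [Fact p.Prime] [CharP R p] (h : IsSymbolPair p a b x y) :
    (-x) ^ p - (-x) = algebraMap F R (-a) := by
  rw [neg_pow, neg_one_pow_char, map_neg, ← h.pow_sub]
  noncomm_ring

theorem pow_pred_pow [Fact p.Prime] (h : IsSymbolPair p a b x y) (hb : b ≠ 0) :
    (b⁻¹ • y ^ (p - 1)) ^ p = algebraMap F R b⁻¹ := by
  have hp := (Fact.out : p.Prime)
  rw [smul_pow, ← pow_mul, mul_comm, pow_mul, h.pow_eq, ← map_pow, Algebra.smul_def, ← map_mul]
  congr 1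
  obtain ⟨n, rfl⟩ : ∃ n, p = n + 1 := ⟨p - 1, (Nat.succ_pred_eq_of_pos hp.pos).symm⟩
  rw [Nat.add_sub_cancel, pow_succ, mul_right_comm, ← mul_pow, inv_mul_cancel₀ hb, one_pow, one_mul]

theorem pow_pred_mul [Fact p.Prime] [CharP R p] (h : IsSymbolPair p a b x y) :
    (b⁻¹ • y ^ (p - 1)) * x = (x - 1) * (b⁻¹ • y ^ (p - 1)) := by
  have hp := (Fact.out : p.Prime)
  rw [smul_mul_assoc, h.y_pow_mul_x, Nat.cast_sub hp.one_le, CharP.cast_eq_zero R p,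
    mul_smul_comm]
  simp [sub_eq_add_neg]

theorem exists_pairs_same_right [Fact p.Prime] [CharP R p] {a' : F} {x₁ y₁ x₂ y₂ : R}
    (hb : b ≠ 0) (h₁ : IsSymbolPair p a b x₁ y₁) (h₂ : IsSymbolPair p a' b x₂ y₂)
    (hxx : Commute x₁ x₂) (hxy : Commute x₁ y₂) (hyx : Commute y₁ x₂) (hyy : Commute y₁ y₂) :
    ∃ x₃ y₃ x₄ y₄ : R, IsSymbolPair p (a + a') b x₃ y₃ ∧ IsSymbolPair p a' 1 x₄ y₄ ∧
      Commute x₃ x₄ ∧ Commute x₃ y₄ ∧ Commute y₃ x₄ ∧ Commute y₃ y₄ := by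
  have hv := h₁.pow_pred_mul
  have hvp := h₁.pow_pred_pow hb
  have hvx : Commute x₂ (b⁻¹ • y₁ ^ (p - 1)) := ((hyx.pow_left _).smul_left _).symm
  have hvy : Commute y₂ (b⁻¹ • y₁ ^ (p - 1)) := ((hyy.pow_left _).smul_left _).symm
  have hvy' : Commute y₁ (b⁻¹ • y₁ ^ (p - 1)) := ((Commute.refl y₁).pow_right _).smul_right _
  generalize b⁻¹ • y₁ ^ (p - 1) = v at *
  have h₄ := h₂.mul_right hvp hvx hvy
  rw [mul_inv_cancel₀ hb] at h₄
  refine ⟨_, _, _, _, h₁.add_left h₂.pow_sub hxx hyx, h₄,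
    hxx.add_left (Commute.refl _), ?_, hyx, hyy.mul_right hvy'⟩
  rw [commute_iff_eq, mul_assoc, mul_add, hv, ← hvx.eq, add_mul, mul_add, ← mul_assoc x₁ y₂,
    hxy.eq, ← mul_assoc y₂ x₂, h₂.y_mul_x]
  noncomm_ring

theorem exists_pairs_mul [Fact p.Prime] [CharP R p] {a' c : F} {x₁ y₁ x₂ y₂ : R}
    (h₁ : IsSymbolPair p a b x₁ y₁) (h₂ : IsSymbolPair p a' c x₂ y₂)
    (hxx : Commute x₁ x₂) (hxy : Commute x₁ y₂) (hyx : Commute y₁ x₂) (hyy : Commute y₁ y₂) :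
    ∃ x₃ y₃ x₄ y₄ : R, IsSymbolPair p a (b * c) x₃ y₃ ∧ IsSymbolPair p (a' - a) c x₄ y₄ ∧
      Commute x₃ x₄ ∧ Commute x₃ y₄ ∧ Commute y₃ x₄ ∧ Commute y₃ y₄ := by
  rw [sub_eq_add_neg]
  refine ⟨_, _, _, _, h₁.mul_right h₂.pow_eq hxy hyy,
    h₂.add_left h₁.pow_sub_neg hxx.symm.neg_right hxy.symm.neg_right,
    hxx.add_right (Commute.refl _).neg_right, hxy, ?_, hyy.mul_left (Commute.refl _)⟩
  rw [commute_iff_eq, mul_assoc, mul_add, h₂.y_mul_x, mul_neg, ← hxy.eq, add_mul, mul_add,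
    mul_add, mul_neg, ← mul_assoc y₁ x₂, hyx.eq, ← mul_assoc y₁ x₁, h₁.y_mul_x]
  noncomm_ring

end IsSymbolPair

namespace SymbolAlg

open BrauerMonoid

variable {F : Type} [Field F] {p : ℕ}

theorem commute_lift {R : Type*} [Ring R] [Algebra F R] {a b : F} {x y t : R}
    (h : IsSymbolPair p a b x y) (hx : Commute x t) (hy : Commute y t) (s : SymbolAlg F p a b) :
    Commute (lift h s) t := by
  have hs : s ∈ Algebra.adjoin F {X p a b, Y p a b} := by rw [adjoin_eq_top]; trivial
  induction hs using Algebra.adjoin_induction with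
  | mem s hs =>
    rcases hs with rfl | hs
    · rwa [lift_X]
    · rwa [Set.mem_singleton_iff.1 hs, lift_Y]
  | algebraMap c => rw [AlgHom.commutes]; exact Algebra.commutes c t
  | add s s' _ _ hs hs' => rw [map_add]; exact hs.add_left hs'
  | mul s s' _ _ hs hs' => rw [map_mul]; exact hs.mul_left hs'

theorem mk_mul_mk_eq [Fact p.Prime] [CharP F p] {a₁ b₁ a₂ b₂ a₃ b₃ a₄ b₄ : F} (hb₁ : b₁ ≠ 0) (hb₂ : b₂ ≠ 0) (hb₃ : b₃ ≠ 0)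
    (hb₄ : b₄ ≠ 0) {x₃ y₃ x₄ y₄ : SymbolAlg F p a₁ b₁ ⊗[F] SymbolAlg F p a₂ b₂}
    (h₃ : IsSymbolPair p a₃ b₃ x₃ y₃) (h₄ : IsSymbolPair p a₄ b₄ x₄ y₄)
    (hxx : Commute x₃ x₄) (hxy : Commute x₃ y₄) (hyx : Commute y₃ x₄) (hyy : Commute y₃ y₄) :
    mk F (SymbolAlg F p a₁ b₁) * mk F (SymbolAlg F p a₂ b₂) =
      mk F (SymbolAlg F p a₃ b₃) * mk F (SymbolAlg F p a₄ b₄) := by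
  have := finiteDimensional (p := p) (a := a₁) hb₁
  have := finiteDimensional (p := p) (a := a₂) hb₂
  have := finiteDimensional (p := p) (a := a₃) hb₃
  have := finiteDimensional (p := p) (a := a₄) hb₄
  have := isSimpleRing (p := p) (a := a₃) hb₃
  have := isSimpleRing (p := p) (a := a₄) hb₄
  have := isCentral (p := p) (a := a₃) hb₃
  have := nontrivial (p := p) (a := a₁) (b := b₁)
  have := nontrivial (p := p) (a := a₂) (b := b₂)
  have := Algebra.TensorProduct.isSimpleRing_of_isCentral (F := F) (A := SymbolAlg F p a₃ b₃)
    (B := SymbolAlg F p a₄ b₄)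
  rw [← mk_tensor, ← mk_tensor]
  refine (mk_eq_mk_of_algHom (Algebra.TensorProduct.lift (lift h₃) (lift h₄) ?_) ?_).symm
  · intro s t
    refine commute_lift h₃ ?_ ?_ s
    · exact (commute_lift h₄ hxx.symm hxy.symm t).symm
    · exact (commute_lift h₄ hyx.symm hyy.symm t).symm
  · simp only [Module.finrank_tensorProduct, finrank_eq hb₁, finrank_eq hb₂, finrank_eq hb₃,
      finrank_eq hb₄]

theorem exists_commuting_pairs (a b a' b' : F) :
    ∃ x₁ y₁ x₂ y₂ : SymbolAlg F p a b ⊗[F] SymbolAlg F p a' b',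
      IsSymbolPair p a b x₁ y₁ ∧ IsSymbolPair p a' b' x₂ y₂ ∧
      Commute x₁ x₂ ∧ Commute x₁ y₂ ∧ Commute y₁ x₂ ∧ Commute y₁ y₂ :=
  ⟨_, _, _, _,
    (isSymbolPair p a b).map (Algebra.TensorProduct.includeLeft (S := F)),
    (isSymbolPair p a' b').map (Algebra.TensorProduct.includeRight (R := F)),
    by simp [commute_iff_eq], by simp [commute_iff_eq], by simp [commute_iff_eq],
    by simp [commute_iff_eq]⟩

variable [Fact p.Prime] [CharP F p]

theorem mk_mul_mk_same_right {a a' b : F} (hb : b ≠ 0) :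
    mk F (SymbolAlg F p a b) * mk F (SymbolAlg F p a' b) =
      mk F (SymbolAlg F p (a + a') b) * mk F (SymbolAlg F p a' 1) := by
  obtain ⟨x₁, y₁, x₂, y₂, h₁, h₂, hxx, hxy, hyx, hyy⟩ := exists_commuting_pairs (p := p) a b a' b
  have := nontrivial (p := p) (a := a) (b := b)
  have := nontrivial (p := p) (a := a') (b := b)
  have : CharP (SymbolAlg F p a b ⊗[F] SymbolAlg F p a' b) p :=
    charP_of_injective_algebraMap (algebraMap F _).injective p
  obtain ⟨_, _, _, _, h₃, h₄, hxx, hxy, hyx, hyy⟩ :=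
    IsSymbolPair.exists_pairs_same_right hb h₁ h₂ hxx hxy hyx hyy
  exact mk_mul_mk_eq hb hb hb one_ne_zero h₃ h₄ hxx hxy hyx hyy

theorem mk_mul_mk_left {a a' b c : F} (hb : b ≠ 0) (hc : c ≠ 0) :
    mk F (SymbolAlg F p a b) * mk F (SymbolAlg F p a' c) =
      mk F (SymbolAlg F p a (b * c)) * mk F (SymbolAlg F p (a' - a) c) := by
  obtain ⟨x₁, y₁, x₂, y₂, h₁, h₂, hxx, hxy, hyx, hyy⟩ := exists_commuting_pairs (p := p) a b a' c
  have := nontrivial (p := p) (a := a) (b := b)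
  have := nontrivial (p := p) (a := a') (b := c)
  have : CharP (SymbolAlg F p a b ⊗[F] SymbolAlg F p a' c) p :=
    charP_of_injective_algebraMap (algebraMap F _).injective p
  obtain ⟨_, _, _, _, h₃, h₄, hxx, hxy, hyx, hyy⟩ :=
    IsSymbolPair.exists_pairs_mul h₁ h₂ hxx hxy hyx hyy
  exact mk_mul_mk_eq hb hc (mul_ne_zero hb hc) hc h₃ h₄ hxx hxy hyx hyy

theorem mk_eq_one_of_pair {a b : F} (hb : b ≠ 0) {V : Type} [AddCommGroup V] [Module F V]
    [FiniteDimensional F V] {x y : Module.End F V} (h : IsSymbolPair p a b x y)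
    (hV : Module.finrank F V = p) : mk F (SymbolAlg F p a b) = 1 := by
  have := isSimpleRing (p := p) (a := a) hb
  have := finiteDimensional (p := p) (a := a) hb
  have : Nontrivial V := Module.nontrivial_of_finrank_pos (R := F)
    (by rw [hV]; exact (Fact.out : p.Prime).pos)
  exact mk_eq_one_of_algHom (lift h) (by rw [hV, finrank_eq hb])

theorem mk_pow_sub_eq_one (c : F) {b : F} (hb : b ≠ 0) :
    mk F (SymbolAlg F p (c ^ p - c) b) = 1 := by
  obtain ⟨x, y, h⟩ := isSymbolPair_shift (p := p) (K := F) (u := c) (a := c ^ p - c) (b := b) rfl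
    (g := Function.update 1 0 b) (by rw [Finset.prod_update_of_mem (Finset.mem_univ _)]; simp)
  exact mk_eq_one_of_pair hb h (by simp [ZMod.card])

end SymbolAlg

section ArtinSchreier

open Polynomial

theorem prod_zmod_sub_eq {S : Type*} [CommRing S] (p : ℕ) [Fact p.Prime] [CharP S p] (t : S) :
    ∏ i : ZMod p, (t - ZMod.castHom (dvd_refl p) S i) = t ^ p - t := by
  have hp := (Fact.out : p.Prime)
  have hr := FiniteField.roots_X_pow_card_sub_X (ZMod p)
  rw [ZMod.card] at hr
  have hm : (X ^ p - X : (ZMod p)[X]).Monic := by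
    have := monic_X_pow_sub (p := (X : (ZMod p)[X])) (n := p) (by
      rw [degree_X]; exact_mod_cast hp.one_lt)
    exact this
  have h := prod_multiset_X_sub_C_of_monic_of_roots_card_eq hm (by
    rw [hr, FiniteField.X_pow_card_sub_X_natDegree_eq _ hp.one_lt]; simp [ZMod.card])
  rw [hr] at h
  have h2 := congrArg (Polynomial.eval₂ (ZMod.castHom (dvd_refl p) S) t) h
  have h3 : (Multiset.map (fun a => X - C a) (Finset.univ : Finset (ZMod p)).val).prod =
    ∏ i : ZMod p, (X - C i : (ZMod p)[X]) := rfl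
  rw [h3, eval₂_finsetProd] at h2
  simpa using h2

theorem prod_range_add_eq {S : Type*} [CommRing S] (p : ℕ) [Fact p.Prime] [CharP S p] (t : S) :
    ∏ i ∈ Finset.range p, (t + i) = t ^ p - t := by
  rw [← prod_zmod_sub_eq p t, Finset.prod_range fun n => t + (n : S)]
  refine Fintype.prod_bijective (fun n : Fin p => -((n : ℕ) : ZMod p)) ?_ _ _ (fun n => ?_)
  · rw [Fintype.bijective_iff_injective_and_card]
    refine ⟨fun m n hmn => Fin.ext ?_, by simp [ZMod.card]⟩
    exact CharP.natCast_injOn_Iio (ZMod p) p m.2 n.2 (neg_injective hmn)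
  · rw [map_neg, map_natCast, sub_neg_eq_add]

variable {F : Type} [Field F] (p : ℕ) (a : F)

/-- The Artin–Schreier polynomial `X ^ p - X - a`. -/
noncomputable def asPoly : F[X] := X ^ p - X - C a

theorem eval₂_asPoly {S : Type*} [CommRing S] (i : F →+* S) (t : S) :
    eval₂ i t (asPoly p a) = t ^ p - t - i a := by
  simp [asPoly]

theorem root_pow_sub : AdjoinRoot.root (asPoly p a) ^ p - AdjoinRoot.root (asPoly p a) =
    algebraMap F _ a := by
  have := AdjoinRoot.eval₂_root (asPoly p a)
  rwa [eval₂_asPoly, sub_eq_zero] at this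

variable [Fact p.Prime]

theorem natDegree_X_add_C_lt : (X + C a : F[X]).degree < (p : WithBot ℕ) := by
  rw [degree_X_add_C]; exact_mod_cast (Fact.out : p.Prime).one_lt

theorem asPoly_monic : (asPoly p a).Monic := by
  rw [asPoly, sub_sub]
  exact monic_X_pow_sub (natDegree_X_add_C_lt p a)

theorem natDegree_asPoly : (asPoly p a).natDegree = p := by
  rw [asPoly, sub_sub, natDegree_sub_eq_left_of_natDegree_lt, natDegree_X_pow]
  rw [natDegree_X_add_C, natDegree_X_pow]
  exact (Fact.out : p.Prime).one_lt

/-- The power basis of the Artin–Schreier algebra. -/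
noncomputable def asBasis : Module.Basis (Fin p) F (AdjoinRoot (asPoly p a)) :=
  (AdjoinRoot.powerBasis' (asPoly_monic p a)).basis.reindex (finCongr (natDegree_asPoly p a))

theorem asBasis_apply (i : Fin p) : asBasis p a i = AdjoinRoot.root (asPoly p a) ^ (i : ℕ) := by
  simp [asBasis]
  rfl

theorem finrank_as : Module.finrank F (AdjoinRoot (asPoly p a)) = p := by
  rw [Module.finrank_eq_card_basis (asBasis p a), Fintype.card_fin]

instance : Nontrivial (AdjoinRoot (asPoly p a)) :=
  Module.nontrivial_of_finrank_pos (R := F)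
    (by rw [finrank_as]; exact (Fact.out : p.Prime).pos)

instance : FiniteDimensional F (AdjoinRoot (asPoly p a)) :=
  Module.Finite.of_basis (asBasis p a)

/-- The norm form of the Artin–Schreier algebra in the coordinates of its power basis. -/
noncomputable def normForm : MvPolynomial (Fin p) F :=
  Matrix.det (∑ j : Fin p, (MvPolynomial.X j : MvPolynomial (Fin p) F) •
    (Algebra.leftMulMatrix (asBasis p a) (asBasis p a j)).map
      (MvPolynomial.C : F →+* MvPolynomial (Fin p) F))

theorem normForm_isHomogeneous : (normForm p a).IsHomogeneous p := by
  rw [normForm, Matrix.det_apply']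
  refine MvPolynomial.IsHomogeneous.sum _ _ _ fun σ _ => ?_
  have h1 := MvPolynomial.IsHomogeneous.prod (Finset.univ : Finset (Fin p))
    (fun i => (∑ j : Fin p, (MvPolynomial.X j : MvPolynomial (Fin p) F) •
    (Algebra.leftMulMatrix (asBasis p a) (asBasis p a j)).map
      (MvPolynomial.C : F →+* MvPolynomial (Fin p) F)) (σ i) i) (fun _ => 1) (by
      intro i _
      rw [Matrix.sum_apply]
      refine MvPolynomial.IsHomogeneous.sum _ _ _ fun j _ => ?_
      rw [Matrix.smul_apply, Matrix.map_apply, smul_eq_mul]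
      exact (MvPolynomial.isHomogeneous_X _ _).mul (MvPolynomial.isHomogeneous_C _ _))
  rw [Finset.sum_const, Finset.card_univ, Fintype.card_fin, smul_eq_mul, mul_one] at h1
  have h2 : (((Equiv.Perm.sign σ : ℤˣ) : ℤ) : MvPolynomial (Fin p) F) =
      MvPolynomial.C ((((Equiv.Perm.sign σ : ℤˣ) : ℤ)) : F) := by simp
  rw [h2]
  have h3 := (MvPolynomial.isHomogeneous_C (Fin p) ((((Equiv.Perm.sign σ : ℤˣ) : ℤ)) : F)).mul h1
  rwa [zero_add] at h3

theorem eval_normForm (v : Fin p → F) :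
    MvPolynomial.eval v (normForm p a) = Algebra.norm F (∑ j, v j • asBasis p a j) := by
  rw [normForm, RingHom.map_det, Algebra.norm_eq_matrix_det (asBasis p a), map_sum]
  congr 1
  ext i k
  simp [Matrix.sum_apply]

variable [CharP F p]

instance : CharP (AdjoinRoot (asPoly p a)) p :=
  charP_of_injective_algebraMap (algebraMap F _).injective p

/-- The automorphism `x ↦ x + 1` of the Artin–Schreier algebra. -/
noncomputable def asShift : AdjoinRoot (asPoly p a) →ₐ[F] AdjoinRoot (asPoly p a) :=
  AdjoinRoot.liftAlgHom _ (Algebra.ofId F _) (AdjoinRoot.root (asPoly p a) + 1) (by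
    have h := root_pow_sub p a
    rw [eval₂_asPoly, add_pow_char, one_pow, add_sub_add_right_eq_sub, h, sub_eq_zero]
    rfl)

theorem asShift_root : asShift p a (AdjoinRoot.root _) = AdjoinRoot.root (asPoly p a) + 1 := by
  simp [asShift]

theorem asShift_iterate_root (n : ℕ) :
    (asShift p a)^[n] (AdjoinRoot.root _) = AdjoinRoot.root (asPoly p a) + n := by
  induction n with
  | zero => simp
  | succ n ih => rw [Function.iterate_succ_apply', ih, map_add, asShift_root, map_natCast]; simp; ring

theorem asShift_iterate_p (v : AdjoinRoot (asPoly p a)) : (asShift p a)^[p] v = v := by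
  have : (asShift p a) ^ p = 1 := by
    refine AdjoinRoot.algHom_ext ?_
    rw [AlgHom.coe_pow, asShift_iterate_root]
    simp
  rw [← AlgHom.coe_pow, this]
  rfl

theorem prod_asShift (f : AdjoinRoot (asPoly p a)) :
    ∏ i ∈ Finset.range p, (asShift p a)^[i] f = algebraMap F _ (Algebra.norm F f) := by
  let x := AdjoinRoot.root (asPoly p a)
  let M := Algebra.leftMulMatrix (asBasis p a) f
  let W : Matrix (Fin p) (Fin p) (AdjoinRoot (asPoly p a)) :=
    Matrix.vandermonde fun i : Fin p => x + ((i : ℕ) : AdjoinRoot (asPoly p a))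
  have hτ : ∀ (i : ℕ) (j : Fin p), (asShift p a)^[i] (asBasis p a j) = (x + i) ^ (j : ℕ) := by
    intro i j
    rw [asBasis_apply, iterate_map_pow, asShift_iterate_root]
  have hW : W * M.map (algebraMap F _) =
      Matrix.diagonal (fun i : Fin p => (asShift p a)^[(i : ℕ)] f) * W := by
    ext i j
    rw [Matrix.diagonal_mul, Matrix.mul_apply]
    simp only [W, Matrix.vandermonde_apply, Matrix.map_apply]
    rw [← hτ, ← iterate_map_mul, ← (asBasis p a).sum_repr (f * asBasis p a j), ← AlgHom.coe_pow,
      map_sum]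
    refine Finset.sum_congr rfl fun k _ => ?_
    rw [map_smul, AlgHom.coe_pow, hτ]
    simp only [M]
    rw [Algebra.leftMulMatrix_eq_repr_mul, Algebra.smul_def, mul_comm]
  have hdet := congrArg Matrix.det hW
  rw [Matrix.det_mul, Matrix.det_mul, Matrix.det_diagonal, mul_comm] at hdet
  have hunit : IsUnit W.det := by
    rw [Matrix.det_vandermonde]
    refine IsUnit.prod_iff.2 fun i _ => IsUnit.prod_iff.2 fun j hj => ?_
    rw [add_sub_add_left_eq_sub]
    have : (((j : ℕ) : AdjoinRoot (asPoly p a)) - ((i : ℕ) : AdjoinRoot (asPoly p a))) =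
      algebraMap F _ (((j : ℕ) : F) - ((i : ℕ) : F)) := by simp
    rw [this]
    refine (IsUnit.mk0 _ (sub_ne_zero.2 fun h => ?_)).map _
    have := CharP.natCast_injOn_Iio F p j.2 i.2 h
    exact (Finset.mem_Ioi.1 hj).ne (Fin.ext this.symm)
  rw [← Fin.prod_univ_eq_prod_range (fun i => (asShift p a)^[i] f), ← hunit.mul_right_cancel hdet,
    Algebra.norm_eq_matrix_det (asBasis p a), RingHom.map_det]
  rfl

theorem exists_pow_sub_of_not_irreducible (h : ¬ Irreducible (asPoly p a)) :
    ∃ c : F, c ^ p - c = a := by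
  have hp := (Fact.out : p.Prime)
  let K := AlgebraicClosure F
  have : CharP K p := charP_of_injective_algebraMap (algebraMap F K).injective p
  obtain ⟨u, hu⟩ := IsAlgClosed.exists_aeval_eq_zero K (asPoly p a) (by
    rw [degree_eq_natDegree (asPoly_monic p a).ne_zero, natDegree_asPoly]
    exact_mod_cast hp.ne_zero)
  have hdvd : minpoly F u ∣ asPoly p a := minpoly.dvd F u hu
  have hxint : IsIntegral F u := ⟨_, asPoly_monic p a, hu⟩
  set g := minpoly F u with hg
  have hgm : g.Monic := minpoly.monic hxint
  have hgp : 0 < g.natDegree := minpoly.natDegree_pos hxint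
  have hlt : g.natDegree < p := by
    refine lt_of_le_of_ne ?_ fun heq => h ?_
    · rw [← natDegree_asPoly p a]
      exact natDegree_le_of_dvd hdvd (asPoly_monic p a).ne_zero
    · rw [eq_of_monic_of_dvd_of_natDegree_le hgm (asPoly_monic p a) hdvd
        (by rw [natDegree_asPoly, heq])]
      exact minpoly.irreducible hxint
  have hroot : ∀ r : K, aeval r (asPoly p a) = 0 → r ^ p - r = algebraMap F K a := by
    intro r hr
    simpa [asPoly, sub_eq_zero] using hr
  have hF : ∀ r ∈ (g.map (algebraMap F K)).roots, r - u ∈ (algebraMap F K).range := by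
    intro r hr
    have h1 : aeval r g = 0 := by
      rw [mem_roots_map hgm.ne_zero] at hr
      exact hr
    have h2 : aeval r (asPoly p a) = 0 := by
      obtain ⟨q, hq⟩ := hdvd
      rw [hq, map_mul, h1, zero_mul]
    have h3 : (r - u) ^ p - (r - u) = 0 := by
      rw [sub_pow_char]
      linear_combination hroot r h2 - hroot u hu
    rw [← prod_zmod_sub_eq p, Finset.prod_eq_zero_iff] at h3
    obtain ⟨i, _, hi⟩ := h3
    refine ⟨((i.val : ℕ) : F), ?_⟩
    rw [map_natCast, sub_eq_zero.1 hi]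
    conv_rhs => rw [← ZMod.natCast_zmod_val i]
    rw [map_natCast]
  have hsplit : (g.map (algebraMap F K)).Splits := IsAlgClosed.splits _
  have hsum := hsplit.nextCoeff_eq_neg_sum_roots_of_monic (hgm.map _)
  rw [nextCoeff_map (algebraMap F K).injective] at hsum
  have hcard : Multiset.card (g.map (algebraMap F K)).roots = g.natDegree := by
    rw [← hsplit.natDegree_eq_card_roots, natDegree_map]
  have hsum2 : (g.map (algebraMap F K)).roots.sum =
      ((g.map (algebraMap F K)).roots.map fun r => r - u).sum + g.natDegree • u := by
    rw [Multiset.sum_map_sub, Multiset.map_id', Multiset.map_const', Multiset.sum_replicate, hcard]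
    abel
  have hmem : g.natDegree • u ∈ (algebraMap F K).range := by
    have : g.natDegree • u = -algebraMap F K g.nextCoeff -
      ((g.map (algebraMap F K)).roots.map fun r => r - u).sum := by
      rw [hsum, hsum2]; abel
    rw [this]
    refine sub_mem (neg_mem ⟨_, rfl⟩) (Subring.multiset_sum_mem _ _ ?_)
    intro t ht
    obtain ⟨r, hr, rfl⟩ := Multiset.mem_map.1 ht
    exact hF r hr
  obtain ⟨t, ht⟩ := hmem
  have hn : (g.natDegree : F) ≠ 0 := by
    rw [Ne, CharP.cast_eq_zero_iff F p]
    exact fun hd => absurd (Nat.le_of_dvd hgp hd) (not_le.2 hlt)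
  have huF : algebraMap F K (t / g.natDegree) = u := by
    rw [map_div₀, ht, map_natCast, nsmul_eq_mul, mul_div_cancel_left₀]
    rw [← map_natCast (algebraMap F K)]
    exact (_root_.map_ne_zero _).2 hn
  refine ⟨t / g.natDegree, (algebraMap F K).injective ?_⟩
  rw [map_sub, map_pow, huF, hroot u hu]

theorem exists_pow_sub_of_normForm_eq_zero {v : Fin p → F} (hv : v ≠ 0)
    (h : MvPolynomial.eval v (normForm p a) = 0) : ∃ c : F, c ^ p - c = a := by
  by_contra hc
  have hirr : Irreducible (asPoly p a) := by
    by_contra hirr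
    exact hc (exists_pow_sub_of_not_irreducible p a hirr)
  have := Fact.mk hirr
  rw [eval_normForm, Algebra.norm_eq_zero_iff] at h
  exact hv (funext fun j => Fintype.linearIndependent_iff.1 (asBasis p a).linearIndependent v h j)

end ArtinSchreier

namespace SymbolAlg

open BrauerMonoid

variable {F : Type} [Field F] {p : ℕ} [Fact p.Prime] [CharP F p]

theorem mk_norm_eq_one {a b : F} (hb : b ≠ 0) {f : AdjoinRoot (asPoly p a)}
    (hf : ∏ i ∈ Finset.range p, (asShift p a)^[i] f = algebraMap F _ b) :
    mk F (SymbolAlg F p a b) = 1 :=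
  mk_eq_one_of_pair hb (IsSymbolPair.of_twisted (asShift p a) (root_pow_sub p a)
    (asShift_root p a) hf (asShift_iterate_p p a)) (finrank_as p a)

theorem mk_eval_normForm {a : F} {v : Fin p → F} (h : MvPolynomial.eval v (normForm p a) ≠ 0) :
    mk F (SymbolAlg F p a (MvPolynomial.eval v (normForm p a))) = 1 :=
  mk_norm_eq_one h (f := ∑ j, v j • asBasis p a j) (by rw [prod_asShift, eval_normForm])

theorem mk_one_right (a : F) : mk F (SymbolAlg F p a 1) = 1 :=
  mk_norm_eq_one one_ne_zero (f := 1) (by rw [prod_asShift, map_one])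

theorem mk_self {b : F} (hb : b ≠ 0) : mk F (SymbolAlg F p b b) = 1 :=
  mk_norm_eq_one hb (f := AdjoinRoot.root _) (by
    simp only [asShift_iterate_root]
    rw [prod_range_add_eq, root_pow_sub])

end SymbolAlg

/-- The formal properties of the symbols `[a, b)` with values in an abelian group. -/
structure IsSymbolMap (p : ℕ) [Fact p.Prime] {F : Type} [Field F] {G : Type*} [AddCommGroup G]
    (s : F → F → G) : Prop where
  add_left : ∀ a a' b, s (a + a') b = s a b + s a' b
  mul_right : ∀ a b c, b ≠ 0 → c ≠ 0 → s a (b * c) = s a b + s a c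
  self : ∀ b, s b b = 0
  pow_sub : ∀ c b, s (c ^ p - c) b = 0
  norm : ∀ a v, s a (MvPolynomial.eval v (normForm p a)) = 0

namespace IsSymbolMap

variable {p : ℕ} [Fact p.Prime] {F : Type} [Field F] {G : Type*} [AddCommGroup G]
  {s : F → F → G} (hs : IsSymbolMap p s)
include hs

theorem zero_left (b : F) : s 0 b = 0 := by
  have := hs.add_left 0 0 b
  rwa [add_zero, left_eq_add] at this

theorem neg_left (a b : F) : s (-a) b = -s a b := by
  rw [eq_neg_iff_add_eq_zero, ← hs.add_left, neg_add_cancel, hs.zero_left]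

theorem sub_left (a a' b : F) : s (a - a') b = s a b - s a' b := by
  rw [sub_eq_add_neg, hs.add_left, hs.neg_left, sub_eq_add_neg]

theorem sum_left {ι : Type*} (t : Finset ι) (a : ι → F) (b : F) :
    s (∑ i ∈ t, a i) b = ∑ i ∈ t, s (a i) b :=
  map_sum (AddMonoidHom.mk' (fun x => s x b) fun x y => hs.add_left x y b) a t

theorem one_right (a : F) : s a 1 = 0 := by
  have := hs.mul_right a 1 1 one_ne_zero one_ne_zero
  rwa [mul_one, left_eq_add] at this

theorem div_right (a : F) {b c : F} (hb : b ≠ 0) (hc : c ≠ 0) : s a (b / c) = s a b - s a c := by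
  rw [eq_sub_iff_add_eq, ← hs.mul_right _ _ _ (div_ne_zero hb hc) hc, div_mul_cancel₀ _ hc]

theorem pow_right (a : F) {b : F} (hb : b ≠ 0) (n : ℕ) : s a (b ^ n) = s (n * a) b := by
  induction n with
  | zero => simp [hs.one_right, hs.zero_left]
  | succ n ih =>
    rw [pow_succ, hs.mul_right _ _ _ (pow_ne_zero _ hb) hb, ih, ← hs.add_left]
    congr 1
    push_cast
    ring

theorem pow_char_right [CharP F p] (a : F) {b : F} (hb : b ≠ 0) : s a (b ^ p) = 0 := by
  rw [hs.pow_right a hb, CharP.cast_eq_zero, zero_mul, hs.zero_left]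

theorem mul_self_right {a b : F} (ha : a ≠ 0) (hb : b ≠ 0) : s (a * b) b = -s (a * b) a := by
  rw [eq_neg_iff_add_eq_zero, add_comm, ← hs.mul_right _ _ _ ha hb, hs.self]

theorem mul_pow_char_left [CharP F p] {a : F} (ha : a ≠ 0) (c : F) : s (a * c ^ p) a = 0 := by
  rcases eq_or_ne c 0 with rfl | hc
  · rw [zero_pow (Fact.out : p.Prime).ne_zero, mul_zero, hs.zero_left]
  · rw [← neg_eq_zero, ← hs.mul_self_right ha (pow_ne_zero _ hc), hs.pow_char_right _ hc]

/-- A nontrivial zero of the form built from the norm forms makes one of the symbols trivial. -/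
theorem exists_eq_zero_of_relation [CharP F p] {ι : Type*} [Fintype ι] [DecidableEq ι] [Nonempty ι]
    (a b : ι → F) (hb : ∀ i, b i ≠ 0) (ha : ∀ i, a i ≠ 0) (S : Finset ι) (l c : F)
    (h0 : l = 0 → S.Nonempty)
    (h : l ^ p * ∑ i, a i + (c ^ p - l ^ (p - 1) * c) + ∑ i ∈ S, b i = 0) :
    ∃ (i₀ : ι) (a' b' : ι → F), (∀ i, b' i ≠ 0) ∧ s (a' i₀) (b' i₀) = 0 ∧
      ∑ i, s (a' i) (b' i) = ∑ i, s (a i) (b i) := by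
  have hp := (Fact.out : p.Prime)
  rcases eq_or_ne l 0 with rfl | hl
  · obtain ⟨i₀, hi₀⟩ := h0 rfl
    rw [zero_pow hp.ne_zero, zero_mul, zero_add, zero_pow (Nat.sub_ne_zero_of_lt hp.one_lt),
      zero_mul, sub_zero, ← Finset.add_sum_erase S b hi₀] at h
    set g := a i₀ / b i₀ with hg
    have hg0 : g ≠ 0 := div_ne_zero (ha _) (hb _)
    have hga : a i₀ = g * b i₀ := (div_mul_cancel₀ _ (hb _)).symm
    have key : s (a i₀) (b i₀) = -∑ i ∈ S.erase i₀, s (g * b i) (b i) := by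
      rw [hga, hs.mul_self_right hg0 (hb _),
        show g * b i₀ = -(g * c ^ p + ∑ i ∈ S.erase i₀, g * b i) by
          rw [← Finset.mul_sum]; linear_combination g * h,
        hs.neg_left, hs.add_left, hs.mul_pow_char_left hg0, hs.sum_left, zero_add, neg_neg,
        ← Finset.sum_neg_distrib]
      exact Finset.sum_congr rfl fun i _ => by rw [hs.mul_self_right hg0 (hb i), neg_neg]
    refine ⟨i₀, fun i => if i = i₀ then 0 else a i - if i ∈ S then g * b i else 0, b, hb,
      by simp [hs.zero_left], ?_⟩
    have h1 : ∀ i, s (if i = i₀ then 0 else a i - if i ∈ S then g * b i else 0) (b i) =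
        (s (a i) (b i) - if i = i₀ then s (a i₀) (b i₀) else 0) -
          if i ∈ S.erase i₀ then s (g * b i) (b i) else 0 := by
      intro i
      rcases eq_or_ne i i₀ with rfl | hi
      · simp [hs.zero_left]
      · by_cases hiS : i ∈ S <;> simp [hi, hiS, hs.sub_left]
    rw [Finset.sum_congr rfl fun i _ => h1 i, Finset.sum_sub_distrib, Finset.sum_sub_distrib,
      Finset.sum_ite_eq' Finset.univ, if_pos (Finset.mem_univ _), Finset.sum_ite_mem,
      Finset.univ_inter, key]
    abel
  · have hlp := pow_ne_zero p hl
    obtain ⟨i₀⟩ := ‹Nonempty ι›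
    let b₁ : ι → F := fun i => b i / l ^ p
    have hb₁ : ∀ i, b₁ i ≠ 0 := fun i => div_ne_zero (hb i) hlp
    have hsb₁ : ∀ i, s (a i) (b₁ i) = s (a i) (b i) := fun i => by
      rw [hs.div_right _ (hb i) hlp, hs.pow_char_right _ hl, sub_zero]
    let a₁ : ι → F := fun i => a i + if i ∈ S then b₁ i else 0
    have hsa₁ : ∀ i, s (a₁ i) (b₁ i) = s (a i) (b i) := fun i => by
      simp only [a₁]
      rw [hs.add_left, hsb₁]
      split_ifs
      · rw [hs.self, add_zero]
      · rw [hs.zero_left, add_zero]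
    have hsum : ∑ i, a₁ i = -((c / l) ^ p - c / l) := by
      have h2 : l ^ p * ∑ i ∈ S, b₁ i = ∑ i ∈ S, b i := by
        rw [Finset.mul_sum]
        exact Finset.sum_congr rfl fun i _ => mul_div_cancel₀ _ hlp
      have h3 : l ^ p * (c / l) = l ^ (p - 1) * c := by
        obtain ⟨q, hq⟩ := Nat.exists_eq_succ_of_ne_zero hp.ne_zero
        rw [hq, Nat.succ_sub_one, pow_succ]
        field_simp
      refine mul_left_cancel₀ hlp ?_
      simp only [a₁]
      rw [Finset.sum_add_distrib, Finset.sum_ite_mem, Finset.univ_inter, mul_add, h2, mul_neg,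
        mul_sub, h3, ← mul_pow, mul_div_cancel₀ _ hl]
      linear_combination h
    refine ⟨i₀, fun i => if i = i₀ then ∑ i, a₁ i else a₁ i,
      fun i => if i = i₀ then b₁ i₀ else b₁ i / b₁ i₀, fun i => ?_, ?_, ?_⟩
    · dsimp only
      split_ifs
      · exact hb₁ _
      · exact div_ne_zero (hb₁ _) (hb₁ _)
    · simp only [if_true]
      rw [hsum, hs.neg_left, hs.pow_sub, neg_zero]
    · have h1 : ∀ i, s (if i = i₀ then ∑ i, a₁ i else a₁ i)
          (if i = i₀ then b₁ i₀ else b₁ i / b₁ i₀) =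
          (s (a i) (b i) - s (a₁ i) (b₁ i₀)) +
            if i = i₀ then ∑ i, s (a₁ i) (b₁ i₀) else 0 := by
        intro i
        split_ifs with hi
        · rw [hs.sum_left, hi, ← hsa₁, sub_self, zero_add]
        · rw [hs.div_right _ (hb₁ _) (hb₁ _), hsa₁, add_zero]
      rw [Finset.sum_congr rfl fun i _ => h1 i, Finset.sum_add_distrib, Finset.sum_sub_distrib,
        Finset.sum_ite_eq' Finset.univ, if_pos (Finset.mem_univ _), sub_add_cancel]

end IsSymbolMap

theorem MvPolynomial.IsHomogeneous.card_le_of_anisotropic {F : Type} [Field F] {p d : ℕ}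
    (hd₁ : ∀ (n : ℕ) (φ : MvPolynomial (Fin n) F), φ.IsHomogeneous p →
      (∀ v : Fin n → F, MvPolynomial.eval v φ = 0 → v = 0) → n ≤ d)
    {κ : Type*} [Fintype κ] {φ : MvPolynomial κ F} (hφ : φ.IsHomogeneous p)
    (h : ∀ v : κ → F, MvPolynomial.eval v φ = 0 → v = 0) : Fintype.card κ ≤ d := by
  refine hd₁ _ (MvPolynomial.rename (Fintype.equivFin κ) φ) hφ.rename_isHomogeneous fun v hv => ?_
  rw [MvPolynomial.eval_rename] at hv
  have := h _ hv
  funext i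
  simpa using congrFun this ((Fintype.equivFin κ).symm i)

namespace IsSymbolMap

open MvPolynomial

variable {p : ℕ} [Fact p.Prime] {F : Type} [Field F] [CharP F p] {G : Type*} [AddCommGroup G]
  {s : F → F → G}

theorem exists_eq_zero_of_card (hs : IsSymbolMap p s) {d : ℕ}
    (hd₁ : ∀ (n : ℕ) (φ : MvPolynomial (Fin n) F), φ.IsHomogeneous p →
      (∀ v : Fin n → F, MvPolynomial.eval v φ = 0 → v = 0) → n ≤ d)
    {ι : Type*} [Fintype ι] [DecidableEq ι] [Nonempty ι]
    (hd : d < 2 + Fintype.card ι * p) (a b : ι → F) (hb : ∀ i, b i ≠ 0) :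
    ∃ (i₀ : ι) (a' b' : ι → F), (∀ i, b' i ≠ 0) ∧ s (a' i₀) (b' i₀) = 0 ∧
      ∑ i, s (a' i) (b' i) = ∑ i, s (a i) (b i) := by
  classical
  have hp := (Fact.out : p.Prime)
  by_cases hA : ∃ i c, c ^ p - c = a i
  · obtain ⟨i, c, hc⟩ := hA
    exact ⟨i, a, b, hb, by rw [← hc, hs.pow_sub], rfl⟩
  have ha : ∀ i, a i ≠ 0 := fun i h => hA ⟨i, 0, by rw [h, zero_pow hp.ne_zero, sub_zero]⟩
  let κ := Fin 2 ⊕ (ι × Fin p)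
  let φ : MvPolynomial κ F :=
    C (∑ i, a i) * X (Sum.inl 0) ^ p +
      (X (Sum.inl 1) ^ p - X (Sum.inl 0) ^ (p - 1) * X (Sum.inl 1)) +
      ∑ i, C (b i) * rename (fun j => Sum.inr (i, j)) (normForm p (a i))
  have hφ : φ.IsHomogeneous p := by
    have h1 : ∀ k : κ, ((X k : MvPolynomial κ F) ^ p).IsHomogeneous p := fun k => by
      simpa using (isHomogeneous_X F k).pow p
    have h2 : ∀ k l : κ, ((X k : MvPolynomial κ F) ^ (p - 1) * X l).IsHomogeneous p := fun k l => by
      have := ((isHomogeneous_X F k).pow (p - 1)).mul (isHomogeneous_X F l)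
      rwa [one_mul, Nat.sub_add_cancel hp.one_le] at this
    have h3 : ∀ (t : F) {ψ : MvPolynomial κ F}, ψ.IsHomogeneous p → (C t * ψ).IsHomogeneous p :=
      fun t ψ hψ => by simpa using (isHomogeneous_C κ t).mul hψ
    refine ((h3 _ (h1 _)).add ((h1 _).sub (h2 _ _))).add
      (IsHomogeneous.sum _ _ _ fun i _ => h3 _ ?_)
    exact (normForm_isHomogeneous p (a i)).rename_isHomogeneous
  obtain ⟨w, hw, hw0⟩ : ∃ w : κ → F, eval w φ = 0 ∧ w ≠ 0 := by
    by_contra hcon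
    push Not at hcon
    have := hφ.card_le_of_anisotropic hd₁ hcon
    simp only [κ, Fintype.card_sum, Fintype.card_fin, Fintype.card_prod] at this
    omega
  let v : ι → Fin p → F := fun i j => w (Sum.inr (i, j))
  have hv : ∀ i, v i ≠ 0 → eval (v i) (normForm p (a i)) ≠ 0 := fun i hi h =>
    hA ⟨i, exists_pow_sub_of_normForm_eq_zero p (a i) hi h⟩
  let S : Finset ι := Finset.univ.filter fun i => v i ≠ 0
  let b₁ : ι → F := fun i => if v i = 0 then b i else b i * eval (v i) (normForm p (a i))
  have hb₁ : ∀ i, b₁ i ≠ 0 := by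
    intro i
    simp only [b₁]
    split_ifs with h
    · exact hb i
    · exact mul_ne_zero (hb i) (hv i h)
  have hsb₁ : ∀ i, s (a i) (b₁ i) = s (a i) (b i) := by
    intro i
    simp only [b₁]
    split_ifs with h
    · rfl
    · rw [hs.mul_right _ _ _ (hb i) (hv i h), hs.norm, add_zero]
  have hsum : ∑ i ∈ S, b₁ i = ∑ i, b i * eval (v i) (normForm p (a i)) := by
    rw [Finset.sum_filter]
    refine Finset.sum_congr rfl fun i _ => ?_
    simp only [b₁]
    split_ifs with h
    · rfl
    · rw [not_not] at h
      rw [h, show eval (0 : Fin p → F) (normForm p (a i)) = 0 from ?_, mul_zero]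
      rw [MvPolynomial.eval_zero, MvPolynomial.constantCoeff_eq]
      exact (normForm_isHomogeneous p (a i)).coeff_eq_zero (by simpa using hp.ne_zero.symm)
  have hrel : w (Sum.inl 0) ^ p * ∑ i, a i +
      (w (Sum.inl 1) ^ p - w (Sum.inl 0) ^ (p - 1) * w (Sum.inl 1)) + ∑ i ∈ S, b₁ i = 0 := by
    rw [hsum, ← hw]
    simp only [φ, map_add, map_sub, map_mul, map_pow, map_sum, eval_C, eval_X, eval_rename]
    rw [mul_comm]
    rfl
  obtain ⟨i₀, a', b', h1, h2, h3⟩ := hs.exists_eq_zero_of_relation a b₁ hb₁ ha S _ _ (by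
    intro hl
    by_contra hS
    rw [Finset.not_nonempty_iff_eq_empty] at hS
    have hv0 : ∀ i, v i = 0 := by simpa [S] using Finset.filter_eq_empty_iff.1 hS
    rw [hS, hl, Finset.sum_empty, zero_pow hp.ne_zero,
      zero_pow (Nat.sub_ne_zero_of_lt hp.one_lt)] at hrel
    have hc : w (Sum.inl 1) = 0 := eq_zero_of_pow_eq_zero (n := p) (by simpa using hrel)
    refine hw0 (funext fun k => ?_)
    rcases k with k | ⟨i, j⟩
    · fin_cases k
      · exact hl
      · exact hc
    · exact congrFun (hv0 i) j) hrel
  exact ⟨i₀, a', b', h1, h2, by rw [h3]; exact Finset.sum_congr rfl fun i _ => hsb₁ i⟩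

/-- A sum of symbols can be written with at most `(d - 2) / p` symbols. -/
theorem exists_sum_eq (hs : IsSymbolMap p s) {d : ℕ} (hd : 1 < d)
    (hd₁ : ∀ (n : ℕ) (φ : MvPolynomial (Fin n) F), φ.IsHomogeneous p →
      (∀ v : Fin n → F, MvPolynomial.eval v φ = 0 → v = 0) → n ≤ d)
    (m : ℕ) (a b : Fin m → F) (hb : ∀ i, b i ≠ 0) :
    ∃ (n : ℕ) (a' b' : Fin n → F), 2 + n * p ≤ d ∧ (∀ i, b' i ≠ 0) ∧
      ∑ i, s (a' i) (b' i) = ∑ i, s (a i) (b i) := by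
  induction m with
  | zero => exact ⟨0, a, b, by omega, hb, rfl⟩
  | succ m ih =>
    by_cases hm : 2 + (m + 1) * p ≤ d
    · exact ⟨m + 1, a, b, hm, hb, rfl⟩
    · obtain ⟨i₀, a', b', h1, h2, h3⟩ := hs.exists_eq_zero_of_card hd₁
        (by rw [Fintype.card_fin]; omega) a b hb
      obtain ⟨n, a'', b'', hn, hb'', h4⟩ := ih (fun i => a' (i₀.succAbove i))
        (fun i => b' (i₀.succAbove i)) fun i => h1 _
      refine ⟨n, a'', b'', hn, hb'', ?_⟩
      rw [h4, ← h3, Fin.sum_univ_succAbove _ i₀, h2, zero_add]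

end IsSymbolMap

namespace SymbolAlg

open BrauerMonoid

variable {F : Type} [Field F] {p : ℕ} [Fact p.Prime] [CharP F p]

theorem mk_mul_mk_same {a a' b : F} (hb : b ≠ 0) :
    mk F (SymbolAlg F p a b) * mk F (SymbolAlg F p a' b) = mk F (SymbolAlg F p (a + a') b) := by
  rw [mk_mul_mk_same_right hb, mk_one_right, mul_one]

theorem mk_zero_left {b : F} (hb : b ≠ 0) : mk F (SymbolAlg F p 0 b) = 1 := by
  have := mk_pow_sub_eq_one (p := p) (0 : F) hb
  rwa [zero_pow (Fact.out : p.Prime).ne_zero, sub_zero] at this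

variable (p) in
/-- The Brauer class of the symbol algebra `[a, b)`, and `0` if `b = 0`. -/
noncomputable def symbolClass (a b : F) : Additive (BrauerMonoid F)ˣ :=
  open Classical in
  if hb : b ≠ 0 then Additive.ofMul ⟨mk F (SymbolAlg F p a b), mk F (SymbolAlg F p (-a) b),
    by rw [mk_mul_mk_same hb, add_neg_cancel, mk_zero_left hb],
    by rw [mk_mul_mk_same hb, neg_add_cancel, mk_zero_left hb]⟩ else 0

theorem symbolClass_zero (a : F) : symbolClass p a 0 = 0 := by
  rw [symbolClass, dif_neg (by simp)]

theorem val_symbolClass (a : F) {b : F} (hb : b ≠ 0) :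
    ((symbolClass p a b).toMul : BrauerMonoid F) = mk F (SymbolAlg F p a b) := by
  rw [symbolClass, dif_pos hb]
  rfl

theorem val_sum_symbolClass {m : ℕ} (a b : Fin m → F) (hb : ∀ i, b i ≠ 0) :
    ((∑ i, symbolClass p (a i) (b i)).toMul : BrauerMonoid F) =
      ∏ i, mk F (SymbolAlg F p (a i) (b i)) := by
  rw [toMul_sum, Units.coe_prod]
  exact Finset.prod_congr rfl fun i _ => val_symbolClass _ (hb i)

theorem symbolClass_eq_zero {a b : F} (h : b ≠ 0 → mk F (SymbolAlg F p a b) = 1) :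
    symbolClass p a b = 0 := by
  rcases eq_or_ne b 0 with rfl | hb
  · exact symbolClass_zero a
  · refine Additive.toMul.injective (Units.ext ?_)
    rw [val_symbolClass _ hb, h hb]
    rfl

theorem isSymbolMap_symbolClass : IsSymbolMap p (symbolClass p : F → F → _) where
  add_left a a' b := by
    rcases eq_or_ne b 0 with rfl | hb
    · simp [symbolClass_zero]
    · refine Additive.toMul.injective (Units.ext ?_)
      rw [toMul_add, Units.val_mul, val_symbolClass _ hb, val_symbolClass _ hb,
        val_symbolClass _ hb, mk_mul_mk_same hb]
  mul_right a b c hb hc := by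
    refine Additive.toMul.injective (Units.ext ?_)
    rw [toMul_add, Units.val_mul, val_symbolClass _ hb, val_symbolClass _ hc,
      val_symbolClass _ (mul_ne_zero hb hc), mk_mul_mk_left hb hc, sub_self, mk_zero_left hc,
      mul_one]
  self b := symbolClass_eq_zero mk_self
  pow_sub c b := symbolClass_eq_zero (mk_pow_sub_eq_one c)
  norm a v := symbolClass_eq_zero mk_eval_normForm

end SymbolAlg

/-- Derivations of matrix algebras are inner. -/
theorem Matrix.exists_eq_commutator_of_leibniz {n R : Type*} [Fintype n] [DecidableEq n]
    [CommRing R] (D : Matrix n n R →ₗ[R] Matrix n n R)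
    (hD : ∀ m m', D (m * m') = D m * m' + m * D m') : ∃ c, ∀ m, D m = c * m - m * c := by
  rcases isEmpty_or_nonempty n with hn | ⟨⟨i₀⟩⟩
  · exact ⟨0, fun m => Subsingleton.elim _ _⟩
  let c : Matrix n n R := ∑ i, D (single i i₀ 1) * single i₀ i 1
  refine ⟨c, fun m => ?_⟩
  suffices D = LinearMap.mulLeft R c - LinearMap.mulRight R c by
    conv_lhs => rw [this]
    rfl
  refine Matrix.ext_linearMap R fun j k => LinearMap.ext_ring ?_
  simp only [LinearMap.comp_apply, LinearMap.sub_apply, LinearMap.mulLeft_apply,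
    LinearMap.mulRight_apply, c]
  change D (single j k 1) = _ * single j k 1 - single j k 1 * _
  have h1 : (∑ i, D (single i i₀ 1) * single i₀ i 1) * single j k 1 =
      D (single j i₀ 1) * single i₀ k 1 := by
    rw [Finset.sum_mul, Finset.sum_eq_single j]
    · rw [mul_assoc, single_mul_single_same, one_mul]
    · intro i _ hi
      rw [mul_assoc, single_mul_single_of_ne (h := hi), mul_zero]
    · simp
  have h2 : single j k 1 * (∑ i, D (single i i₀ 1) * single i₀ i 1) =
      D (single j i₀ 1) * single i₀ k 1 - D (single j k 1) := by
    have h3 : ∀ i, single j k 1 * (D (single i i₀ 1) * single i₀ i 1) =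
        D (single j k 1 * single i i₀ 1) * single i₀ i 1 - D (single j k 1) * single i i 1 := by
      intro i
      rw [hD, add_mul, mul_assoc (D (single j k 1)), single_mul_single_same, one_mul, mul_assoc]
      abel
    rw [Finset.mul_sum, Finset.sum_congr rfl fun i _ => h3 i, Finset.sum_sub_distrib,
      ← Finset.mul_sum]
    congr 1
    · rw [Finset.sum_eq_single k]
      · rw [single_mul_single_same, one_mul]
      · intro i _ hi
        rw [single_mul_single_of_ne (h := hi.symm), map_zero, zero_mul]
      · simp
    · rw [sum_single_one, mul_one]
  rw [h1, h2]
  abel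

/-- On a purely inseparable extension `K(y)` of degree `p` with `y ^ p ∈ K` there is a
`K`-derivation with `y ↦ -y` and field of constants `K`. -/
theorem PowerBasis.exists_derivation {K L : Type*} [Field K] [Field L] [Algebra K L] (p : ℕ)
    [Fact p.Prime] [CharP K p] (pb : PowerBasis K L) (hdim : pb.dim = p) {b : K}
    (hb : pb.gen ^ p = algebraMap K L b) :
    ∃ θ : L →ₗ[K] L, (∀ l l', θ (l * l') = θ l * l' + l * θ l') ∧ θ pb.gen = -pb.gen ∧
      ∀ l, θ l = 0 → l ∈ (algebraMap K L).range := by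
  have hp := (Fact.out : p.Prime)
  have hchar : CharP L p := charP_of_injective_algebraMap (algebraMap K L).injective p
  let y := pb.gen
  let θ : L →ₗ[K] L := pb.basis.constr K fun i => -((i : ℕ) : L) * y ^ (i : ℕ)
  have hθ : ∀ i : ℕ, i < p → θ (y ^ i) = -(i : L) * y ^ i := by
    intro i hi
    have := pb.basis.constr_basis K (fun i => -((i : ℕ) : L) * y ^ (i : ℕ)) ⟨i, hdim ▸ hi⟩
    rwa [pb.basis_eq_pow] at this
  have hθ1 : ∀ c : K, θ (algebraMap K L c) = 0 := by
    intro c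
    have := hθ 0 hp.pos
    rw [pow_zero, Nat.cast_zero, neg_zero, zero_mul] at this
    rw [Algebra.algebraMap_eq_smul_one, map_smul, this, smul_zero]
  have hy : ∀ l, θ (y * l) = -y * l + y * θ l := by
    have : θ ∘ₗ LinearMap.mulLeft K y = LinearMap.mulLeft K (-y) + LinearMap.mulLeft K y ∘ₗ θ := by
      refine pb.basis.ext fun i => ?_
      simp only [LinearMap.comp_apply, LinearMap.add_apply, LinearMap.mulLeft_apply,
        pb.basis_eq_pow]
      change θ (y * y ^ (i : ℕ)) = -y * y ^ (i : ℕ) + y * θ (y ^ (i : ℕ))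
      have hi : (i : ℕ) < p := hdim ▸ i.2
      rw [hθ _ hi, ← pow_succ']
      rcases Nat.lt_or_ge ((i : ℕ) + 1) p with h | h
      · rw [hθ _ h]
        push_cast
        ring
      · have hip : (i : ℕ) + 1 = p := by omega
        have hcast : ((i : ℕ) : L) + 1 = 0 := by
          rw [← Nat.cast_succ, Nat.succ_eq_add_one, hip, CharP.cast_eq_zero]
        rw [hip, hb, hθ1]
        linear_combination (y * y ^ (i : ℕ)) * hcast
    exact fun l => LinearMap.congr_fun this l
  have hθy : θ y = -y := by simpa using hθ 1 hp.one_lt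
  refine ⟨θ, fun l l' => ?_, hθy, fun l hl => ?_⟩
  · have hl : l ∈ Algebra.adjoin K {y} := by rw [pb.adjoin_gen_eq_top]; trivial
    induction hl using Algebra.adjoin_induction generalizing l' with
    | mem x hx =>
      rw [Set.mem_singleton_iff.1 hx, hy, hθy]
    | algebraMap r => rw [hθ1, zero_mul, zero_add, ← Algebra.smul_def, map_smul, Algebra.smul_def]
    | add x z _ _ hx hz => rw [add_mul, map_add, map_add, hx, hz]; ring
    | mul x z _ _ hx hz => rw [mul_assoc, hx, hz, hx]; ring
  · have h0 : ∀ i : Fin pb.dim, (i : ℕ) ≠ 0 → pb.basis.repr l i = 0 := by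
      intro i hi
      have h1 : ∑ j : Fin pb.dim, (-((j : ℕ) : K) * pb.basis.repr l j) • pb.basis j = 0 := by
        rw [← hl]
        conv_rhs => rw [← pb.basis.sum_repr l, map_sum]
        refine Finset.sum_congr rfl fun j _ => ?_
        rw [map_smul, pb.basis_eq_pow]
        change _ = _ • θ (y ^ (j : ℕ))
        rw [hθ _ (hdim ▸ j.2), Algebra.smul_def, Algebra.smul_def, map_mul, map_neg, map_natCast]
        ring
      have h2 := Fintype.linearIndependent_iff.1 pb.basis.linearIndependent _ h1 i
      refine (mul_eq_zero.1 h2).resolve_left (neg_ne_zero.2 fun h3 => hi ?_)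
      exact Nat.eq_zero_of_dvd_of_lt ((CharP.cast_eq_zero_iff K p _).1 h3) (hdim ▸ i.2)
    have hpos : 0 < pb.dim := hdim ▸ hp.pos
    refine ⟨pb.basis.repr l ⟨0, hpos⟩, ?_⟩
    conv_rhs => rw [← pb.basis.sum_repr l]
    rw [Finset.sum_eq_single ⟨0, hpos⟩]
    · rw [pb.basis_eq_pow, pow_zero, Algebra.algebraMap_eq_smul_one]
    · intro i _ hi
      rw [h0 i fun h => hi (Fin.ext h), zero_smul]
    · simp

/-- The action of matrices over an extension field `L` on `L ^ n` as a representation over a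
smaller field. -/
noncomputable def Matrix.toEndRestrictScalars (F K : Type*) {L ι : Type*} [Field F] [Field K]
    [Field L] [Algebra F K] [Algebra F L] [Algebra K L] [IsScalarTower F K L] [Fintype ι]
    [DecidableEq ι] : Matrix ι ι L →ₐ[F] Module.End K (ι → L) where
  toFun m := (Matrix.toLin' m).restrictScalars K
  map_one' := by rw [Matrix.toLin'_one]; rfl
  map_mul' m m' := by rw [Matrix.toLin'_mul]; rfl
  map_zero' := by rw [map_zero]; rfl
  map_add' m m' := by rw [map_add]; rfl
  commutes' r := by
    ext v i
    simp [Matrix.algebraMap_eq_diagonal, Matrix.mulVec_diagonal, Module.algebraMap_end_apply,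
      Algebra.smul_def]

section SymbolSplitting

variable {F K L : Type*} [Field F] [Field K] [Field L] [Algebra F K] [Algebra F L] [Algebra K L]
  [IsScalarTower F K L] {ι : Type*} [Fintype ι] [DecidableEq ι]

/-- A representation of a central simple algebra of degree `n` on `L ^ n` identifies its scalar
extension to `L` with the matrix algebra. -/
theorem AlgHom.bijective_lift_matrix {F L A : Type*} [Field F] [Field L] [Algebra F L] [Ring A]
    [Algebra F A] [FiniteDimensional F A] [IsSimpleRing A] [Algebra.IsCentral F A]
    {ι : Type*} [Fintype ι] [DecidableEq ι] (ρ : A →ₐ[F] Matrix ι ι L)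
    (hρ : Module.finrank F A = Fintype.card ι ^ 2) :
    Function.Bijective (Algebra.TensorProduct.lift (Algebra.ofId L (Matrix ι ι L)) ρ
      fun x y => Algebra.commutes x (ρ y)) := by
  have h1 : IsSimpleRing (A ⊗[F] L) := Algebra.TensorProduct.isSimpleRing_of_isCentral
  have h2 : IsSimpleRing (L ⊗[F] A) :=
    .of_ringEquiv (Algebra.TensorProduct.comm F A L).toRingEquiv h1
  have hι : Nonempty ι := by
    by_contra hι
    rw [not_nonempty_iff] at hι
    rw [Fintype.card_eq_zero] at hρ
    exact (Module.finrank_pos (R := F) (M := A)).ne' hρ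
  set Φ := Algebra.TensorProduct.lift (Algebra.ofId L (Matrix ι ι L)) ρ
      fun x y => Algebra.commutes x (ρ y)
  have hinj : Function.Injective Φ := Φ.toRingHom.injective
  refine ⟨hinj, ?_⟩
  refine (LinearMap.injective_iff_surjective_of_finrank_eq_finrank (f := Φ.toLinearMap) ?_).1 hinj
  rw [Module.finrank_baseChange, hρ, Module.finrank_matrix, Module.finrank_self, mul_one, sq]

theorem Matrix.exists_toEnd_eq_smul_of_commute {Z : Module.End K (ι → L)}
    (hsmul : ∀ (l : L) v, Z (l • v) = l • Z v)
    (hmat : ∀ m : Matrix ι ι L, Commute Z (Matrix.toEndRestrictScalars K K m)) :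
    ∃ l : L, ∀ v, Z v = l • v := by
  let z : (ι → L) →ₗ[L] (ι → L) := { Z with map_smul' := hsmul }
  have hz : ∀ m, Commute m (LinearMap.toMatrix' z) := by
    intro m
    refine Matrix.toLin'.injective ?_
    rw [Matrix.toLin'_mul, Matrix.toLin'_mul, Matrix.toLin'_toMatrix']
    ext1 v
    exact LinearMap.ext fun v => (LinearMap.congr_fun (hmat m) _).symm
  obtain ⟨l, hl⟩ := Matrix.mem_range_scalar_of_commute_single fun i j _ => hz (single i j 1)
  refine ⟨l, fun v => ?_⟩
  have : z v = (Matrix.toLin' (Matrix.scalar ι l)) v := by rw [hl, Matrix.toLin'_toMatrix']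
  change z v = _
  rw [this]
  ext i
  simp [Matrix.mulVec_diagonal]

end SymbolSplitting

theorem exists_isSymbolPair_of_rep (F : Type*) {K L A : Type*} [Field F] [Field K] [Field L]
    [Algebra F K] [Algebra F L] [Algebra K L] [IsScalarTower F K L] [Ring A]
    [Algebra F A] [FiniteDimensional F A] [IsSimpleRing A] [Algebra.IsCentral F A]
    {ι : Type*} [Fintype ι] [DecidableEq ι] (p : ℕ) [Fact p.Prime] [CharP F p]
    (hK : ∀ x : K, x ^ p ∈ (algebraMap F K).range) (pb : PowerBasis K L) (hdim : pb.dim = p)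
    {b : F} (hb : pb.gen ^ p = algebraMap F L b) (ρ : A →ₐ[F] Matrix ι ι L)
    (hρ : Module.finrank F A = Fintype.card ι ^ 2) :
    ∃ (a : F) (x y : Module.End K (ι → L)), IsSymbolPair p a b x y ∧
      ∀ r, Commute x (Matrix.toEndRestrictScalars F K (ρ r)) ∧
        Commute y (Matrix.toEndRestrictScalars F K (ρ r)) := by
  have hp := (Fact.out : p.Prime)
  have : CharP K p := charP_of_injective_algebraMap (algebraMap F K).injective p
  have hι : Nonempty ι := by
    by_contra hι
    rw [not_nonempty_iff] at hι
    rw [Fintype.card_eq_zero] at hρ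
    exact (Module.finrank_pos (R := F) (M := A)).ne' hρ
  have : CharP (Module.End K (ι → L)) p :=
    charP_of_injective_algebraMap (algebraMap K (Module.End K (ι → L))).injective p
  obtain ⟨θ, hθ, hθy, hθ0⟩ := pb.exists_derivation p hdim (b := algebraMap F K b)
    (by rw [hb, IsScalarTower.algebraMap_apply F K L])
  let j := Matrix.toEndRestrictScalars (L := L) (ι := ι) F K
  let Φ := AlgEquiv.ofBijective _ (ρ.bijective_lift_matrix hρ)
  have hΦ : ∀ l r, Φ (l ⊗ₜ r) = l • ρ r := fun l r => by
    rw [Algebra.smul_def]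
    exact Algebra.TensorProduct.lift_tmul (Algebra.ofId L (Matrix ι ι L)) ρ
      (fun x y => Algebra.commutes x (ρ y)) l r
  let D₀ : L ⊗[F] A →ₗ[L] Matrix ι ι L :=
    LinearMap.liftBaseChange L ((θ.restrictScalars F).mapMatrix ∘ₗ ρ.toLinearMap)
  have hD₀ : ∀ l r, D₀ (l ⊗ₜ r) = l • (ρ r).map θ := fun l r => by
    simp [D₀]
  have hmap : ∀ m m' : Matrix ι ι L, (m * m').map θ = m.map θ * m' + m * m'.map θ := by
    intro m m'
    ext i k
    simp [Matrix.mul_apply, map_sum, hθ, Finset.sum_add_distrib]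
  have hleib : ∀ u v, D₀ (u * v) = D₀ u * Φ v + Φ u * D₀ v := by
    intro u v
    induction u using TensorProduct.induction_on with
    | zero => simp
    | add u₁ u₂ h₁ h₂ => rw [add_mul, map_add, map_add, map_add, h₁, h₂, add_mul, add_mul]; abel
    | tmul l r =>
      induction v using TensorProduct.induction_on with
      | zero => simp
      | add u₁ u₂ h₁ h₂ => rw [mul_add, map_add, map_add, map_add, h₁, h₂, mul_add, mul_add]; abel
      | tmul l' r' =>
        rw [Algebra.TensorProduct.tmul_mul_tmul, hD₀, hD₀, hD₀, hΦ, hΦ, map_mul, hmap,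
          smul_mul_smul_comm, smul_mul_smul_comm, smul_add]
  obtain ⟨c, hc⟩ := Matrix.exists_eq_commutator_of_leibniz (D₀ ∘ₗ Φ.symm.toLinearMap) (by
    intro m m'
    simpa using hleib (Φ.symm m) (Φ.symm m'))
  have hcρ : ∀ r, (ρ r).map θ = c * ρ r - ρ r * c := by
    intro r
    have h := hc (ρ r)
    have h1 : Φ.symm (ρ r) = 1 ⊗ₜ r := by rw [AlgEquiv.symm_apply_eq, hΦ, one_smul]
    simp only [LinearMap.comp_apply, AlgEquiv.toLinearMap_apply, h1, hD₀, one_smul] at h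
    exact h
  let Θ : Module.End K (ι → L) := θ.compLeft ι
  have hΘj : ∀ m, Θ * j m = j (m.map θ) + j m * Θ := by
    intro m
    refine LinearMap.ext fun v => funext fun i => ?_
    change θ ((m.mulVec v) i) = ((m.map θ).mulVec v) i + (m.mulVec fun i => θ (v i)) i
    simp [Matrix.mulVec, dotProduct, hθ, Finset.sum_add_distrib]
  let Y : L → Module.End K (ι → L) := fun l => Algebra.lsmul K K (ι → L) l
  have hYj : ∀ l m, Commute (Y l) (j m) := by
    intro l m
    refine LinearMap.ext fun v => ?_
    exact (m.mulVec_smul l v).symm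
  have hΘY : ∀ l, Θ * Y l = Y (θ l) + Y l * Θ := by
    intro l
    refine LinearMap.ext fun v => funext fun i => ?_
    exact hθ l (v i)
  let ξ := Θ - j c
  have hξj : ∀ r, Commute ξ (j (ρ r)) := by
    intro r
    change ξ * j (ρ r) = j (ρ r) * ξ
    simp only [ξ]
    rw [sub_mul, mul_sub, hΘj, hcρ, map_sub, map_mul, map_mul]
    abel
  have hξY : ∀ l, ξ * Y l = Y (θ l) + Y l * ξ := by
    intro l
    simp only [ξ]
    rw [sub_mul, mul_sub, hΘY, (hYj l c).eq]
    abel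
  let y := pb.gen
  have hξy : Y y * ξ = (ξ + 1) * Y y := by
    rw [add_mul, one_mul, hξY, hθy]
    simp only [Y, map_neg]
    change _ = -(Algebra.lsmul K K (ι → L)) y + _ + (Algebra.lsmul K K (ι → L)) y
    abel
  let Z := ξ ^ p - ξ
  have hZy : Commute Z (Y y) := by
    have h1 : Y y * ξ ^ p = (ξ ^ p + 1) * Y y := by
      have := (show SemiconjBy (Y y) ξ (ξ + 1) from hξy).pow_right p
      rw [add_pow_char_of_commute p (Commute.one_right ξ), one_pow] at this
      exact this
    change Z * Y y = Y y * Z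
    simp only [Z]
    rw [mul_sub, sub_mul, h1, hξy]
    noncomm_ring
  have hZY : ∀ l, Commute Z (Y l) := by
    intro l
    have hl : l ∈ Algebra.adjoin K {y} := by rw [pb.adjoin_gen_eq_top]; trivial
    induction hl using Algebra.adjoin_induction with
    | mem x hx => rw [Set.mem_singleton_iff.1 hx]; exact hZy
    | algebraMap r =>
      simp only [Y, AlgHom.commutes]
      exact (Algebra.commutes r Z).symm
    | add x z _ _ hx hz => simp only [Y, map_add]; exact hx.add_right hz
    | mul x z _ _ hx hz => simp only [Y, map_mul]; exact hx.mul_right hz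
  have hZξ : Commute Z ξ := ((Commute.refl ξ).pow_left p).sub_left (Commute.refl ξ)
  have hZj : ∀ m, Commute Z (j m) := by
    intro m
    obtain ⟨u, rfl⟩ := Φ.surjective m
    induction u using TensorProduct.induction_on with
    | zero => simp
    | add u v hu hv => rw [map_add, map_add]; exact hu.add_right hv
    | tmul l r =>
      have : j (Φ (l ⊗ₜ r)) = Y l * j (ρ r) := by
        rw [hΦ]
        refine LinearMap.ext fun v => ?_
        exact Matrix.smul_mulVec l (ρ r) v
      rw [this]
      exact (hZY l).mul_right (((hξj r).pow_left p).sub_left (hξj r))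
  obtain ⟨l, hl⟩ := Matrix.exists_toEnd_eq_smul_of_commute (K := K) (Z := Z)
    (fun l v => LinearMap.congr_fun (hZY l) v) fun m => hZj m
  have hZl : Z = Y l := LinearMap.ext hl
  have hθl : θ l = 0 := by
    have h1 : Y (θ l) = 0 := by
      have := hξY l
      rw [← hZl, hZξ.eq, eq_comm, add_eq_right] at this
      exact this
    obtain ⟨i⟩ := hι
    have := congrFun (LinearMap.congr_fun h1 (fun _ => (1 : L))) i
    simpa [Y] using this
  obtain ⟨a₀, rfl⟩ := hθ0 l hθl
  obtain ⟨a, ha⟩ := hK a₀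
  refine ⟨a, ξ + algebraMap K _ a₀, Y y, ⟨?_, ?_, ?_⟩, fun r => ⟨?_, hYj y _⟩⟩
  · have h1 : Z = algebraMap K _ a₀ := by rw [hZl]; exact AlgHom.commutes _ a₀
    rw [add_pow_char_of_commute p (Algebra.commutes a₀ ξ).symm, add_sub_add_comm,
      show ξ ^ p - ξ = algebraMap K _ a₀ from h1, ← map_pow, add_sub_cancel, ← ha,
      ← IsScalarTower.algebraMap_apply]
  · have : Y y ^ p = Y (y ^ p) := (map_pow _ _ _).symm
    rw [this, show y ^ p = _ from hb, IsScalarTower.algebraMap_apply F K L]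
    simp only [Y, AlgHom.commutes]
    rw [← IsScalarTower.algebraMap_apply]
  · rw [mul_add, add_mul, hξy, (Algebra.commutes a₀ (Y y)).symm]
    noncomm_ring
  · exact (hξj r).add_left (Algebra.commutes a₀ _)

section Albert

open BrauerMonoid

/-- The Brauer class of `A` is a product of classes of symbol algebras of degree `p`. -/
def IsSymbolProduct (p : ℕ) (F : Type) [Field F] (A : Type) [Ring A] [Algebra F A] : Prop :=
  ∃ (m : ℕ) (a b : Fin m → F), (∀ i, b i ≠ 0) ∧ mk F A = ∏ i, mk F (SymbolAlg F p (a i) (b i))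

/-- Every central simple `F`-algebra split by `K` is Brauer equivalent to a product of symbols. -/
def SplitImpliesSymbolProduct (p : ℕ) (F K : Type) [Field F] [Field K] [Algebra F K] : Prop :=
  ∀ (A : Type) [Ring A] [Algebra F A] [FiniteDimensional F A] [IsSimpleRing A]
    [Algebra.IsCentral F A] (n : ℕ) (_ : A →ₐ[F] Matrix (Fin n) (Fin n) K),
    Module.finrank F A = n ^ 2 → IsSymbolProduct p F A

variable {p : ℕ} {F K L : Type} [Field F] [Field K] [Field L] [Algebra F K] [Algebra F L]

theorem SplitImpliesSymbolProduct.of_algEquiv (h : SplitImpliesSymbolProduct p F K)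
    (e : L ≃ₐ[F] K) : SplitImpliesSymbolProduct p F L :=
  fun A _ _ _ _ _ n ρ hρ => h A n (e.mapMatrix.toAlgHom.comp ρ) hρ

theorem splitImpliesSymbolProduct_self : SplitImpliesSymbolProduct p F F := by
  intro A _ _ _ _ _ n ρ hρ
  refine ⟨0, Fin.elim0, Fin.elim0, fun i => i.elim0, ?_⟩
  have hn : Nonempty (Fin n) := by
    rw [← Fin.pos_iff_nonempty]
    by_contra hn
    rw [Nat.eq_zero_of_not_pos hn] at hρ
    exact (Module.finrank_pos (R := F) (M := A)).ne' hρ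
  rw [mk_eq_mk_of_algHom ρ (by
    rw [hρ, Module.finrank_matrix, Module.finrank_self, Fintype.card_fin, mul_one, sq]), mk_matrix,
    Fin.prod_univ_zero]
  rfl

theorem SplitImpliesSymbolProduct.of_powerBasis [Fact p.Prime] [CharP F p] [Algebra K L]
    [IsScalarTower F K L] (h : SplitImpliesSymbolProduct p F K)
    (hK : ∀ x : K, x ^ p ∈ (algebraMap F K).range) (pb : PowerBasis K L) (hdim : pb.dim = p)
    {b : F} (hb : pb.gen ^ p = algebraMap F L b) : SplitImpliesSymbolProduct p F L := by
  intro A _ _ _ _ _ n ρ hρ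
  have : FiniteDimensional K L := pb.finite
  obtain ⟨a, x, y, hxy, hcomm⟩ := exists_isSymbolPair_of_rep F p hK pb hdim hb ρ
    (by rw [hρ, Fintype.card_fin])
  have hb0 : b ≠ 0 := by
    rintro rfl
    rw [map_zero] at hb
    have hg := eq_zero_of_pow_eq_zero hb
    refine pb.basis.ne_zero ⟨1, hdim ▸ (Fact.out : p.Prime).one_lt⟩ ?_
    rw [pb.basis_eq_pow, pow_one, hg]
  have h1 := SymbolAlg.isSimpleRing (p := p) (a := a) hb0
  have h2 := SymbolAlg.isCentral (p := p) (a := a) hb0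
  have h3 := SymbolAlg.finiteDimensional (p := p) (a := a) hb0
  have h4 : IsSimpleRing (A ⊗[F] SymbolAlg F p a b) :=
    Algebra.TensorProduct.isSimpleRing_of_isCentral
  have h5 : Algebra.IsCentral F (A ⊗[F] SymbolAlg F p a b) :=
    Algebra.TensorProduct.isCentral_of_field
  let f : A ⊗[F] SymbolAlg F p a b →ₐ[F] Module.End K (Fin n → L) :=
    Algebra.TensorProduct.lift ((Matrix.toEndRestrictScalars F K).comp ρ) (SymbolAlg.lift hxy)
      fun r s => (SymbolAlg.commute_lift hxy (hcomm r).1 (hcomm r).2 s).symm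
  have hr : Module.finrank K (Fin n → L) = n * p := by
    rw [Module.finrank_pi_fintype, Finset.sum_const, Finset.card_univ, Fintype.card_fin,
      pb.finrank, hdim, smul_eq_mul]
  obtain ⟨m, a', b', hb', hprod⟩ := h (A ⊗[F] SymbolAlg F p a b) _
    (((algEquivMatrix (Module.finBasis K (Fin n → L))).restrictScalars F).toAlgHom.comp f) (by
      rw [hr, Module.finrank_tensorProduct, hρ, SymbolAlg.finrank_eq hb0, mul_pow])
  refine ⟨m + 1, Fin.cons (-a) a', Fin.cons b b', fun i => ?_, ?_⟩
  · refine Fin.cases hb0 hb' i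
  · rw [Fin.prod_univ_succ]
    change mk F A = mk F (SymbolAlg F p (-a) b) * ∏ i, mk F (SymbolAlg F p (a' i) (b' i))
    rw [← hprod, mk_tensor, mul_left_comm, SymbolAlg.mk_mul_mk_same hb0, neg_add_cancel,
      SymbolAlg.mk_zero_left hb0, mul_one]

theorem splitImpliesSymbolProduct_of_pow_mem [Fact p.Prime] [CharP F p] [FiniteDimensional F L]
    (hL : ∀ x : L, x ^ p ∈ (algebraMap F L).range) : SplitImpliesSymbolProduct p F L := by
  suffices ∀ K : IntermediateField F L, SplitImpliesSymbolProduct p F K from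
    (this ⊤).of_algEquiv IntermediateField.topEquiv.symm
  intro K
  induction K using IntermediateField.induction_on_adjoin with
  | base => exact splitImpliesSymbolProduct_self.of_algEquiv (IntermediateField.botEquiv F L)
  | ih K x hK =>
    change SplitImpliesSymbolProduct p F (IntermediateField.adjoin K {x})
    by_cases hx : x ∈ K
    · have h1 : IntermediateField.adjoin K {x} = ⊥ :=
        IntermediateField.adjoin_simple_eq_bot_iff.2 (IntermediateField.mem_bot.2 ⟨⟨x, hx⟩, rfl⟩)
      rw [h1]
      exact hK.of_algEquiv ((IntermediateField.botEquiv K L).restrictScalars F)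
    · have hp := (Fact.out : p.Prime)
      have : CharP L p := charP_of_injective_algebraMap (algebraMap F L).injective p
      obtain ⟨b, hb⟩ := hL x
      have hmon : (Polynomial.X ^ p - Polynomial.C (algebraMap F K b)).Monic :=
        Polynomial.monic_X_pow_sub_C _ hp.ne_zero
      have hroot : Polynomial.aeval x (Polynomial.X ^ p - Polynomial.C (algebraMap F K b)) = 0 := by
        simp only [map_sub, map_pow, Polynomial.aeval_X, Polynomial.aeval_C]
        rw [← IsScalarTower.algebraMap_apply F K L, hb, sub_self]
      have hxint : IsIntegral K x := ⟨_, hmon, hroot⟩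
      have hirr : Irreducible (Polynomial.X ^ p - Polynomial.C (algebraMap F K b)) := by
        refine X_pow_sub_C_irreducible_of_prime hp fun c hc => hx ?_
        have : (c : L) ^ p = x ^ p := by
          rw [← hb, IsScalarTower.algebraMap_apply F K L, ← hc]
          rfl
        have := frobenius_inj L p this
        rw [← this]
        exact c.2
      have hmin := minpoly.eq_of_irreducible_of_monic hirr hroot hmon
      refine hK.of_powerBasis (L := IntermediateField.adjoin K {x}) (fun y => ?_)
        (IntermediateField.adjoin.powerBasis hxint) ?_ (b := b) ?_
      · obtain ⟨c, hc⟩ := hL y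
        exact ⟨c, Subtype.ext hc⟩
      · rw [IntermediateField.adjoin.powerBasis_dim, ← hmin, Polynomial.natDegree_X_pow_sub_C]
      · rw [IntermediateField.adjoin.powerBasis_gen]
        exact Subtype.ext hb.symm

end Albert

/-- A matrix ring over a division ring with a nonzero idempotent whose corner is commutative is a
matrix ring over a commutative ring. -/
theorem Matrix.mul_comm_of_corner_commute {ι D : Type*} [Fintype ι] [DecidableEq ι]
    [DivisionRing D] {e : Matrix ι ι D} (he : e ≠ 0)
    (hcomm : ∀ r s, e * r * e * (e * s * e) = e * s * e * (e * r * e))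
    (hee : e * e = e) (c d : D) : c * d = d * c := by
  obtain ⟨a, b, hx⟩ : ∃ a b, e a b ≠ 0 := by
    by_contra! h
    exact he (Matrix.ext h)
  have key : ∀ c d, c * e a b * d = d * e a b * c := by
    intro c d
    have h := congrFun (congrFun (hcomm (single b a c) (single b a d)) a) b
    have hprod : ∀ r s, e * r * e * (e * s * e) = e * r * e * s * e := fun r s => by
      simp only [mul_assoc]
      rw [← mul_assoc e e, hee]
    have hs : ∀ c d, (e * single b a c * e * single b a d * e) a b
        = e a b * c * e a b * d * e a b := by
      intro c d
      simp [Matrix.mul_apply, single, ite_and, mul_assoc]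
    rw [hprod, hprod, hs, hs] at h
    have h' := mul_right_cancel₀ hx h
    simp only [mul_assoc] at h'
    simpa only [mul_assoc] using mul_left_cancel₀ hx h'
  have hc : ∀ c, c * e a b = e a b * c := fun c => by simpa using key c 1
  have h := key c d
  rw [hc c, hc d, mul_assoc, mul_assoc] at h
  exact mul_left_cancel₀ hx h

/-- A central simple algebra over `F` is split by the extension `K` if its scalar extension `Q`
to `K` has a nonzero idempotent with commutative corner. -/
theorem exists_algHom_matrix_of_corner_commute {F K A Q : Type} [Field F] [Field K] [Algebra F K]
    [Ring A] [Algebra F A] [FiniteDimensional F A] [IsSimpleRing A] [Algebra.IsCentral F A]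
    [Ring Q] [Algebra K Q] (ν : A →+* Q)
    (hν : ∀ l, ν (algebraMap F A l) = algebraMap K Q (algebraMap F K l))
    (hspan : Submodule.span K (Set.range ν) = ⊤) {q : Q} (hq : q ≠ 0) (hqq : q * q = q)
    (hcomm : ∀ r s, q * r * q * (q * s * q) = q * s * q * (q * r * q)) :
    ∃ (n : ℕ) (_ : A →ₐ[F] Matrix (Fin n) (Fin n) K), Module.finrank F A = n ^ 2 := by
  have : Nontrivial Q := ⟨q, 0, hq⟩
  let : Algebra F Q := Algebra.compHom Q (algebraMap F K)
  have : IsScalarTower F K Q := .of_algebraMap_eq fun _ => rfl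
  let ν' : A →ₐ[F] Q := { ν with commutes' := hν }
  have h1 : IsSimpleRing (A ⊗[F] K) := Algebra.TensorProduct.isSimpleRing_of_isCentral
  have h2 : IsSimpleRing (K ⊗[F] A) :=
    .of_ringEquiv (Algebra.TensorProduct.comm F A K).toRingEquiv h1
  let Φ₀ := Algebra.TensorProduct.lift (Algebra.ofId K Q) ν' fun x y => Algebra.commutes x (ν y)
  have hΦ₀ : ∀ k a, Φ₀ (k ⊗ₜ a) = k • ν a := fun k a => by
    rw [Algebra.smul_def]
    exact Algebra.TensorProduct.lift_tmul (Algebra.ofId K Q) ν'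
      (fun x y => Algebra.commutes x (ν y)) k a
  have hsurj : Function.Surjective Φ₀ := by
    rw [← Φ₀.coe_toLinearMap, ← LinearMap.range_eq_top, ← top_le_iff, ← hspan, Submodule.span_le]
    rintro _ ⟨a, rfl⟩
    exact ⟨1 ⊗ₜ a, by rw [AlgHom.toLinearMap_apply, hΦ₀, one_smul]⟩
  let Φ := AlgEquiv.ofBijective Φ₀ ⟨Φ₀.toRingHom.injective, hsurj⟩
  have hQ : IsSimpleRing Q := .of_ringEquiv Φ.toRingEquiv h2
  have hfin : Module.Finite K Q := .equiv Φ.toLinearEquiv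
  have hcenter : ∀ z : Q, (∀ w, w * z = z * w) → ∃ k, algebraMap K Q k = z := by
    intro z hz
    obtain ⟨u, rfl⟩ := Φ.surjective z
    obtain ⟨k, hk⟩ := Algebra.TensorProduct.exists_eq_one_tmul
      (z := Algebra.TensorProduct.comm F K A u) fun a => by
        apply (Algebra.TensorProduct.comm F K A).symm.injective
        apply Φ.injective
        simpa using hz (Φ (1 ⊗ₜ a))
    refine ⟨k, ?_⟩
    have hu : u = k ⊗ₜ 1 := by
      rw [← (Algebra.TensorProduct.comm F K A).symm_apply_apply u, hk]
      rfl
    rw [hu]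
    exact (hΦ₀ k 1).symm ▸ by rw [map_one, Algebra.algebraMap_eq_smul_one]
  have : IsArtinianRing Q := .of_finite K Q
  obtain ⟨n, _, D, _, _, _, ⟨ε⟩⟩ := IsSimpleRing.exists_algEquiv_matrix_divisionRing_finite K Q
  have hD : ∀ c d : D, c * d = d * c := by
    refine Matrix.mul_comm_of_corner_commute (e := ε q) (by simpa using hq) (fun r s => ?_) ?_
    · obtain ⟨r, rfl⟩ := ε.surjective r
      obtain ⟨s, rfl⟩ := ε.surjective s
      simp only [← map_mul, hcomm r s]
    · rw [← map_mul, hqq]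
  have hbij : Function.Bijective (Algebra.ofId K D) := by
    refine ⟨(algebraMap K D).injective, fun c => ?_⟩
    obtain ⟨k, hk⟩ := hcenter (ε.symm (Matrix.scalar (Fin n) c)) fun w => by
      obtain ⟨m, rfl⟩ := ε.symm.surjective w
      rw [← map_mul, ← map_mul]
      congr 1
      ext i j
      simp [hD]
    refine ⟨k, ?_⟩
    have h := congrArg ε hk
    rw [AlgEquiv.apply_symm_apply, AlgEquiv.commutes] at h
    have := congrFun (congrFun h 0) 0
    simpa [Matrix.algebraMap_matrix_apply] using this
  let δ : Q ≃ₐ[K] Matrix (Fin n) (Fin n) K :=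
    ε.trans (AlgEquiv.ofBijective _ hbij).symm.mapMatrix
  refine ⟨n, (δ.toAlgHom.restrictScalars F).comp ν', ?_⟩
  rw [← Module.finrank_baseChange (R := K) (S := F), (Φ.trans δ).toLinearEquiv.finrank_eq,
    Module.finrank_matrix, Module.finrank_self, Fintype.card_fin, mul_one, sq]

section Centralizer

open Polynomial

theorem Ideal.Quotient.commute_end {R : Type*} [CommRing R] (I : Ideal R)
    (f g : Module.End R (R ⧸ I)) : Commute f g := by
  have key : ∀ (f : Module.End R (R ⧸ I)) x, f x = x * f 1 := by
    intro f x
    obtain ⟨y, rfl⟩ := Ideal.Quotient.mk_surjective x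
    calc f (Ideal.Quotient.mk I y) = f (y • 1) := by rw [Algebra.smul_def, mul_one]; rfl
      _ = Ideal.Quotient.mk I y * f 1 := by rw [map_smul, Algebra.smul_def]; rfl
  refine LinearMap.ext fun x => ?_
  rw [Module.End.mul_apply, Module.End.mul_apply, key f (g x), key g (f x), key f x, key g x]
  ring

/-- A finite direct sum of cyclic modules has a complete system of idempotent endomorphisms with
commutative corners. -/
theorem Module.End.exists_idempotents_of_directSum {R M ι : Type*} [CommRing R] [AddCommGroup M]
    [Module R M] [Fintype ι] {I : ι → Ideal R} (ψ : M ≃ₗ[R] DirectSum ι fun i => R ⧸ I i) :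
    ∃ e : ι → Module.End R M, (∀ i, e i * e i = e i) ∧ ∑ i, e i = 1 ∧
      ∀ i r s, e i * r * e i * (e i * s * e i) = e i * s * e i * (e i * r * e i) := by
  classical
  let u : ∀ i, (R ⧸ I i) →ₗ[R] M := fun i => ψ.symm.toLinearMap ∘ₗ DirectSum.lof R ι (fun i => R ⧸ I i) i
  let v : ∀ i, M →ₗ[R] (R ⧸ I i) := fun i => DirectSum.component R ι (fun i => R ⧸ I i) i ∘ₗ ψ.toLinearMap
  have hvu : ∀ i x, v i (u i x) = x := fun i x => by simp [u, v, DirectSum.component.lof_self]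
  refine ⟨fun i => u i ∘ₗ v i, fun i => ?_, ?_, fun i r s => ?_⟩
  · ext x
    simp [hvu]
  · ext x
    apply ψ.injective
    have h : ψ x = ∑ i, DirectSum.lof R ι _ i (DirectSum.component R ι _ i (ψ x)) := by
      conv_lhs => rw [← DirectSum.sum_univ_of (ψ x)]
      rfl
    simp only [LinearMap.sum_apply, map_sum]
    simpa [u, v] using h.symm
  · ext x
    have := LinearMap.congr_fun (Ideal.Quotient.commute_end (I i) (v i ∘ₗ r ∘ₗ u i)
      (v i ∘ₗ s ∘ₗ u i)) (v i x)
    simp only [Module.End.mul_apply, LinearMap.comp_apply, hvu] at this ⊢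
    rw [this]

/-- An endomorphism `g` has a complete system of idempotents in its centralizer whose corners in
the centralizer are commutative. -/
theorem Module.End.exists_idempotents_centralizer {F V : Type} [Field F] [AddCommGroup V]
    [Module F V] [FiniteDimensional F V] (g : Module.End F V) :
    ∃ (ι : Type) (_ : Fintype ι) (e : ι → Module.End F V), (∀ i, Commute (e i) g) ∧
      (∀ i, e i * e i = e i) ∧ ∑ i, e i = 1 ∧
      ∀ i r s, Commute r g → Commute s g →
        e i * r * e i * (e i * s * e i) = e i * s * e i * (e i * r * e i) := by
  let o := AEval'.of g
  have htors : Module.IsTorsion F[X] (AEval' g) := by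
    intro x
    refine ⟨⟨minpoly F g, mem_nonZeroDivisors_of_ne_zero
      (minpoly.ne_zero (Algebra.IsIntegral.isIntegral g))⟩, ?_⟩
    obtain ⟨x, rfl⟩ := o.surjective x
    change minpoly F g • o x = 0
    rw [← AEval.of_aeval_smul, minpoly.aeval, zero_smul, map_zero]
  obtain ⟨ι, _, q, _, k, ⟨ψ⟩⟩ := Module.equiv_directSum_of_isTorsion htors
  obtain ⟨e, he, hsum, hcomm⟩ := Module.End.exists_idempotents_of_directSum ψ
  let β : Module.End F[X] (AEval' g) →+* Module.End F V :=
    { toFun r := o.symm.toLinearMap ∘ₗ r.restrictScalars F ∘ₗ o.toLinearMap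
      map_one' := by ext x; simp
      map_mul' r s := by ext x; simp
      map_zero' := by ext x; simp
      map_add' r s := by ext x; simp }
  have hβ : ∀ r, Commute (β r) g := by
    intro r
    ext x
    change o.symm (r (o (g x))) = g (o.symm (r (o x)))
    rw [← AEval'.X_smul_of, map_smul]
    exact AEval'.of_symm_X_smul g _
  have hβ' : ∀ r, Commute r g → ∃ r', β r' = r := by
    intro r hr
    refine ⟨LinearMap.ofAEval _ (o.toLinearMap ∘ₗ r) fun x => ?_, ?_⟩
    · change o (r (g x)) = (X : F[X]) • o (r x)
      rw [AEval'.X_smul_of]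
      exact congrArg o (LinearMap.congr_fun hr x)
    · ext x
      change o.symm (o (r (o.symm (o x)))) = r x
      simp
  refine ⟨ι, inferInstance, fun i => β (e i), fun i => hβ _, fun i => ?_, ?_, fun i r s hr hs => ?_⟩
  · rw [← map_mul, he]
  · rw [← map_sum, hsum, map_one]
  · obtain ⟨r, rfl⟩ := hβ' r hr
    obtain ⟨s, rfl⟩ := hβ' s hs
    simp only [← map_mul, hcomm i r s]

/-- If `M_n(T)` is a matrix algebra over the base field, then so is `T`. -/
theorem BrauerEquiv.exists_algEquiv_end {F T : Type} [Field F] [Ring T] [Algebra F T]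
    (h : BrauerEquiv F T F) : ∃ (W : Type) (_ : AddCommGroup W) (_ : Module F W)
      (_ : FiniteDimensional F W), Nonempty (T ≃ₐ[F] Module.End F W) := by
  obtain ⟨n, m, hn, hm, ⟨φ⟩⟩ := h
  let ψ := φ.trans (Matrix.toLinAlgEquiv' (R := F) (n := Fin m))
  let i₀ : Fin n := ⟨0, hn⟩
  let S : T →ₗ[F] Module.End F (Fin m → F) := ψ.toLinearMap ∘ₗ Matrix.singleLinearMap F i₀ i₀
  have hS : ∀ t, S t = ψ (Matrix.single i₀ i₀ t) := fun t => rfl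
  have hmul : ∀ s t, S (s * t) = S s * S t := fun s t => by
    rw [hS, hS, hS, ← map_mul, Matrix.single_mul_single_same]
  have hinj : Function.Injective S := by
    intro s t hst
    have := ψ.injective hst
    simpa using congrFun (congrFun this i₀) i₀
  let W := LinearMap.range (S 1)
  have hW : ∀ w : W, S 1 w = w := by
    rintro ⟨_, v, rfl⟩
    change (S 1 * S 1) v = _
    rw [← hmul, one_mul]
  let Θ : T →ₐ[F] Module.End F W := AlgHom.ofLinearMap
    { toFun t := LinearMap.restrict (S t) (p := W) (q := W) fun w _ =>
        ⟨S t w, by rw [← Module.End.mul_apply, ← hmul, one_mul]⟩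
      map_add' s t := LinearMap.ext fun w => Subtype.ext (LinearMap.congr_fun (map_add S s t) w)
      map_smul' c t := LinearMap.ext fun w => Subtype.ext (LinearMap.congr_fun (map_smul S c t) w) }
    (LinearMap.ext fun w => Subtype.ext (hW w))
    (fun s t => LinearMap.ext fun w => Subtype.ext (LinearMap.congr_fun (hmul s t) w))
  refine ⟨W, inferInstance, inferInstance, inferInstance, ⟨AlgEquiv.ofBijective Θ ⟨?_, ?_⟩⟩⟩
  · intro s t hst
    apply hinj
    rw [← mul_one s, ← mul_one t, hmul, hmul]
    refine LinearMap.ext fun v => ?_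
    exact congrArg Subtype.val (LinearMap.congr_fun hst ⟨S 1 v, v, rfl⟩)
  · intro w
    let u : Module.End F (Fin m → F) := W.subtype ∘ₗ w ∘ₗ (S 1).rangeRestrict
    obtain ⟨M, hM⟩ := ψ.surjective u
    have hu : u = S (M i₀ i₀) := by
      have h1 : S 1 * u * S 1 = u := by
        refine LinearMap.ext fun v => ?_
        change S 1 (w ⟨S 1 (S 1 v), _⟩ : W) = (w ⟨S 1 v, _⟩ : W)
        rw [hW]
        congr 3
        exact hW ⟨S 1 v, v, rfl⟩
      rw [← h1, ← hM, hS, hS, ← map_mul, ← map_mul, Matrix.single_mul_mul_single, one_mul, mul_one]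
    refine ⟨M i₀ i₀, LinearMap.ext fun x => Subtype.ext ?_⟩
    change S (M i₀ i₀) x = w x
    rw [← hu]
    change ((w ⟨S 1 x, _⟩ : W) : Fin m → F) = _
    congr 2
    exact Subtype.ext (hW x)

end Centralizer

section CyclicNorm

variable {F T : Type*} [Field F]

/-- The norm map `∑ σ ^ i` of an operator `σ`. -/
def cyclicNorm [AddCommGroup T] [Module F T] (p : ℕ) (σ : Module.End F T) : Module.End F T :=
  ∑ i ∈ Finset.range p, σ ^ i

theorem sum_mem_range_cyclicNorm [AddCommGroup T] [Module F T] {p : ℕ} (hp : p.Prime)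
    (σ : Module.End F T) {X : Type*} [DecidableEq X] {c : X → X} (hc : ∀ x, c^[p] x = x)
    {f : X → T} (hf : ∀ x, f (c x) = σ (f x)) (S : Finset X) (hS : ∀ x ∈ S, c x ∈ S)
    (hfix : ∀ x ∈ S, c x ≠ x) : ∑ x ∈ S, f x ∈ LinearMap.range (cyclicNorm p σ) := by
  induction S using Finset.strongInduction with
  | H S ih =>
    obtain rfl | ⟨x, hx⟩ := S.eq_empty_or_nonempty
    · rw [Finset.sum_empty]
      exact zero_mem _
    have hcinj : Function.Injective c := fun y z h => by
      rw [← hc y, ← hc z, ← Nat.succ_pred_eq_of_pos hp.pos, Function.iterate_succ_apply,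
        Function.iterate_succ_apply, h]
    have hmp : Function.minimalPeriod c x = p :=
      ((Nat.dvd_prime hp).1 (Function.IsPeriodicPt.minimalPeriod_dvd (hc x))).resolve_left
        fun h => hfix x hx (Function.minimalPeriod_eq_one_iff_isFixedPt.1 h)
    let O := (Finset.range p).image fun i => c^[i] x
    have hOS : O ⊆ S := by
      intro y hy
      obtain ⟨i, -, rfl⟩ := Finset.mem_image.1 hy
      clear hy
      induction i with
      | zero => exact hx
      | succ i hi => rw [Function.iterate_succ_apply']; exact hS _ hi
    have hO : ∀ y, c y ∈ O → y ∈ O := by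
      intro y hy
      obtain ⟨i, hi, hiy⟩ := Finset.mem_image.1 hy
      rcases i with _ | i
      · refine Finset.mem_image.2 ⟨p - 1, Finset.mem_range.2 (Nat.sub_lt hp.pos one_pos), ?_⟩
        apply hcinj
        rw [← hiy, ← Function.iterate_succ_apply' c, Nat.succ_eq_add_one,
          Nat.sub_add_cancel hp.one_le, hc]
        rfl
      · refine Finset.mem_image.2 ⟨i, Finset.mem_range.2
          ((Nat.lt_succ_self i).trans (Finset.mem_range.1 hi)), hcinj ?_⟩
        rw [← hiy]
        exact (Function.iterate_succ_apply' c i x).symm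
    rw [← Finset.sum_sdiff hOS]
    refine add_mem (ih _ ?_ ?_ ?_) ⟨f x, ?_⟩
    · exact Finset.sdiff_ssubset hOS
        ⟨x, Finset.mem_image.2 ⟨0, Finset.mem_range.2 hp.pos, rfl⟩⟩
    · intro y hy
      rw [Finset.mem_sdiff] at hy ⊢
      exact ⟨hS y hy.1, fun h => hy.2 (hO y h)⟩
    · exact fun y hy => hfix y (Finset.mem_sdiff.1 hy).1
    · rw [Finset.sum_image, cyclicNorm, LinearMap.sum_apply]
      · refine Finset.sum_congr rfl fun i _ => ?_
        clear * - hf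
        induction i with
        | zero => rfl
        | succ i hi => rw [Function.iterate_succ_apply', hf, ← hi, pow_succ', Module.End.mul_apply]
      · intro i hi j hj h
        refine Function.iterate_injOn_Iio_minimalPeriod (f := c) (x := x) ?_ ?_ h
        · rw [hmp]; exact Finset.mem_range.1 hi
        · rw [hmp]; exact Finset.mem_range.1 hj

variable [Ring T] [Algebra F T]

/-- The ideal of norms in the algebra fixed by `σ`. -/
def normIdeal (p : ℕ) (σ : T ≃ₐ[F] T) :
    Ideal (AlgHom.equalizer (σ : T →ₐ[F] T) (AlgHom.id F T)) where
  carrier := {r | (r : T) ∈ LinearMap.range (cyclicNorm p (σ : T →ₐ[F] T).toLinearMap)}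
  add_mem' h h' := (LinearMap.range (cyclicNorm p (σ : T →ₐ[F] T).toLinearMap)).add_mem h h'
  zero_mem' := zero_mem (LinearMap.range (cyclicNorm p (σ : T →ₐ[F] T).toLinearMap))
  smul_mem' r s := by
    rintro ⟨t, ht⟩
    refine ⟨r * t, ?_⟩
    change _ = (r : T) * s
    rw [← ht]
    simp only [cyclicNorm, LinearMap.sum_apply, Finset.mul_sum]
    refine Finset.sum_congr rfl fun i h => ?_
    clear h
    induction i with
    | zero => rfl
    | succ i hi =>
      rw [pow_succ', Module.End.mul_apply, hi, Module.End.mul_apply]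
      change σ (r * _) = r * σ _
      rw [map_mul]
      congr 1
      exact r.2

instance (p : ℕ) (σ : T ≃ₐ[F] T) : (normIdeal p σ).IsTwoSided where
  mul_mem_of_left {s} r hs := by
    obtain ⟨t, ht⟩ : (s : T) ∈ LinearMap.range (cyclicNorm p (σ : T →ₐ[F] T).toLinearMap) := hs
    refine ⟨t * r, ?_⟩
    change _ = (s : T) * r
    rw [← ht]
    simp only [cyclicNorm, LinearMap.sum_apply, Finset.sum_mul]
    refine Finset.sum_congr rfl fun i h => ?_
    clear h
    induction i with
    | zero => rfl
    | succ i hi =>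
      rw [pow_succ', Module.End.mul_apply, hi, Module.End.mul_apply]
      change σ (_ * r) = σ _ * r
      rw [map_mul]
      congr 1
      exact r.2

/-- If `T` is a matrix algebra, then a nonzero quotient of the algebra fixed by an automorphism
has a nonzero idempotent with commutative corner. -/
theorem exists_idempotent_quotient_equalizer {F T W : Type} [Field F] [Ring T] [Algebra F T]
    [AddCommGroup W] [Module F W] [FiniteDimensional F W] (φ : T ≃ₐ[F] Module.End F W)
    (σ : T ≃ₐ[F] T) (I : Ideal (AlgHom.equalizer (σ : T →ₐ[F] T) (AlgHom.id F T)))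
    [I.IsTwoSided] (hI : I ≠ ⊤) :
    ∃ q : _ ⧸ I, q ≠ 0 ∧ q * q = q ∧
      ∀ r s, q * r * q * (q * s * q) = q * s * q * (q * r * q) := by
  obtain ⟨g, hg⟩ := ((φ.symm.trans σ).trans φ).eq_linearEquivConjAlgEquiv
  have hfix : ∀ t, σ t = t ↔ Commute (φ t) (g : Module.End F W) := by
    intro t
    have h : φ (σ t) * g = g * φ t := by
      have h1 := AlgEquiv.congr_fun hg (φ t)
      simp only [AlgEquiv.trans_apply, AlgEquiv.symm_apply_apply] at h1
      rw [h1]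
      ext x
      simp [LinearEquiv.conjAlgEquiv]
    constructor
    · intro ht
      rw [ht] at h
      exact h
    · intro ht
      rw [← ht.eq] at h
      apply φ.injective
      refine LinearMap.ext fun x => ?_
      obtain ⟨x, rfl⟩ := g.surjective x
      exact LinearMap.congr_fun h x
  obtain ⟨ι, _, e, heg, he, hsum, hcomm⟩ :=
    Module.End.exists_idempotents_centralizer (g : Module.End F W)
  let ε : ι → AlgHom.equalizer (σ : T →ₐ[F] T) (AlgHom.id F T) := fun i =>
    ⟨φ.symm (e i), (hfix _).2 (by rw [φ.apply_symm_apply]; exact heg i)⟩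
  have hε : ∑ i, ε i = 1 := by
    apply Subtype.ext
    rw [AddSubmonoidClass.coe_finsetSum]
    change ∑ i, φ.symm (e i) = 1
    rw [← map_sum, hsum, map_one]
  obtain ⟨i, hi⟩ : ∃ i, ε i ∉ I := by
    by_contra! h
    exact hI ((Ideal.eq_top_iff_one I).2 (hε ▸ sum_mem fun i _ => h i))
  refine ⟨Ideal.Quotient.mk I (ε i), fun h => hi (Ideal.Quotient.eq_zero_iff_mem.1 h), ?_, ?_⟩
  · rw [← map_mul]
    congr 1
    apply Subtype.ext
    change φ.symm (e i) * φ.symm (e i) = φ.symm (e i)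
    rw [← map_mul, he]
  · intro r s
    obtain ⟨r, rfl⟩ := Ideal.Quotient.mk_surjective r
    obtain ⟨s, rfl⟩ := Ideal.Quotient.mk_surjective s
    simp only [← map_mul]
    congr 1
    apply Subtype.ext
    apply φ.injective
    have h := hcomm i _ _ ((hfix _).1 r.2) ((hfix _).1 s.2)
    simpa [ε] using h

end CyclicNorm

/-- The field `F`, regarded as the extension `F ^ (1 / p)` of `F` through the Frobenius. -/
def FrobTwist (F : Type) (_ : ℕ) : Type := F

namespace FrobTwist

instance (F : Type) [Field F] (p : ℕ) : Field (FrobTwist F p) := inferInstanceAs (Field F)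

instance (F : Type) [Field F] (p : ℕ) [ExpChar F p] : Algebra F (FrobTwist F p) :=
  (frobenius F p).toAlgebra

end FrobTwist

section CyclicShift

variable (F A : Type) [Field F] [Ring A] [Algebra F A] (p : ℕ) [NeZero p]

/-- The cyclic shift of the tensor factors of a tensor power. -/
noncomputable def cyclicShift : (⨂[F] (_ : Fin p), A) ≃ₐ[F] (⨂[F] (_ : Fin p), A) :=
  AlgEquiv.ofLinearEquiv
    (PiTensorProduct.reindex F (fun _ => A) (Equiv.addRight (1 : Fin p)).symm)
    (by
      rw [PiTensorProduct.one_def, PiTensorProduct.reindex_tprod]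
      rfl)
    (by
      intro x y
      induction x using PiTensorProduct.induction_on with
      | add x x' hx hx' => rw [add_mul, map_add, map_add, hx, hx', add_mul]
      | smul_tprod r f =>
        induction y using PiTensorProduct.induction_on with
        | add y y' hy hy' => rw [mul_add, map_add, map_add, hy, hy', mul_add]
        | smul_tprod s g =>
          rw [smul_mul_smul_comm, PiTensorProduct.tprod_mul_tprod, map_smul, map_smul, map_smul,
            smul_mul_smul_comm, PiTensorProduct.reindex_tprod, PiTensorProduct.reindex_tprod,
            PiTensorProduct.reindex_tprod, PiTensorProduct.tprod_mul_tprod]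
          rfl)

variable {F A p}

theorem cyclicShift_tprod (x : Fin p → A) :
    cyclicShift F A p (PiTensorProduct.tprod F x) = PiTensorProduct.tprod F fun i => x (i + 1) :=
  PiTensorProduct.reindex_tprod (R := F) (Equiv.addRight (1 : Fin p)).symm x

theorem iterate_comp_add_one {κ : Type*} (x : Fin p → κ) :
    (fun (x : Fin p → κ) i => x (i + 1))^[p] x = x := by
  have h : ∀ n, (fun (x : Fin p → κ) i => x (i + 1))^[n] x = fun i => x (i + n • 1) := by
    intro n
    induction n with
    | zero => simp
    | succ n ih =>
      rw [Function.iterate_succ_apply', ih]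
      funext i
      simp only [succ_nsmul', add_assoc]
  have hp : p • (1 : Fin p) = 0 := by
    have h1 := card_nsmul_eq_zero (x := (1 : Fin p))
    rwa [Fintype.card_fin] at h1
  rw [h, hp]
  simp only [add_zero]

theorem filter_comp_add_one_eq {κ : Type*} [Fintype κ] [DecidableEq κ] :
    (Finset.univ.filter fun x : Fin p → κ => (fun i => x (i + 1)) = x) =
      Finset.univ.image fun k _ => k := by
  ext x
  simp only [Finset.mem_filter, Finset.mem_univ, true_and, Finset.mem_image]
  constructor
  · intro h
    refine ⟨x 0, funext fun i => ?_⟩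
    obtain ⟨n, hn⟩ := i
    induction n with
    | zero => rfl
    | succ n ih =>
      rw [ih (Nat.lt_of_succ_lt hn), ← congrFun h ⟨n, _⟩]
      congr 1
      exact Fin.ext (by simp [Fin.val_add, Nat.mod_eq_of_lt hn])
  · rintro ⟨k, rfl⟩
    rfl

variable {T : Type} [AddCommGroup T] [Module F T]

theorem sum_sub_sum_const_mem_range_cyclicNorm (hp : p.Prime) (σ : Module.End F T) {κ : Type*}
    [Fintype κ] {f : (Fin p → κ) → T} (hf : ∀ x, f (fun i => x (i + 1)) = σ (f x)) :
    ∑ x, f x - ∑ k, f (fun _ => k) ∈ LinearMap.range (cyclicNorm p σ) := by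
  classical
  have h := sum_mem_range_cyclicNorm hp σ (c := fun (x : Fin p → κ) i => x (i + 1))
    iterate_comp_add_one hf
    (Finset.univ.filter fun x : Fin p → κ => ¬ (fun i => x (i + 1)) = x) ?_ ?_
  · rw [← Finset.sum_filter_add_sum_filter_not Finset.univ
      (fun x : Fin p → κ => (fun i => x (i + 1)) = x) f, filter_comp_add_one_eq,
      Finset.sum_image fun k _ l _ h => congrFun h 0, add_sub_cancel_left]
    exact h
  · intro x hx
    rw [Finset.mem_filter] at hx ⊢
    refine ⟨Finset.mem_univ _, fun h => hx.2 (funext fun i => ?_)⟩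
    simpa using congrFun h (i - 1)
  · exact fun x hx => (Finset.mem_filter.1 hx).2

theorem tprod_sum_sub_sum_tprod_mem_range_cyclicNorm (hp : p.Prime) {κ : Type*} [Fintype κ]
    (v : κ → A) :
    PiTensorProduct.tprod F (fun _ : Fin p => ∑ k, v k) -
      ∑ k, PiTensorProduct.tprod F (fun _ : Fin p => v k) ∈
      LinearMap.range (cyclicNorm p (cyclicShift F A p : _ →ₐ[F] _).toLinearMap) := by
  classical
  rw [MultilinearMap.map_sum]
  exact sum_sub_sum_const_mem_range_cyclicNorm hp _
    (f := fun x : Fin p → κ => PiTensorProduct.tprod F fun i => v (x i))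
    fun x => (cyclicShift_tprod (F := F) fun i => v (x i)).symm

theorem exists_sub_sum_mem_range_cyclicNorm (hp : p.Prime) {κ : Type} [Fintype κ]
    (b : Module.Basis κ F A) {t : ⨂[F] (_ : Fin p), A} (ht : cyclicShift F A p t = t) :
    ∃ c : κ → F, t - ∑ k, c k • PiTensorProduct.tprod F (fun _ : Fin p => b k) ∈
      LinearMap.range (cyclicNorm p (cyclicShift F A p : _ →ₐ[F] _).toLinearMap) := by
  classical
  let B := Basis.piTensorProduct fun _ : Fin p => b
  have hB : ∀ t x, B.repr (cyclicShift F A p t) (fun i => x (i + 1)) = B.repr t x := by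
    intro t x
    induction t using PiTensorProduct.induction_on with
    | add t t' h h' => rw [map_add, map_add, map_add, Finsupp.add_apply, h, h', Finsupp.add_apply]
    | smul_tprod r f =>
      rw [map_smul, map_smul, map_smul, Finsupp.smul_apply, Finsupp.smul_apply, cyclicShift_tprod,
        Basis.piTensorProduct_repr_tprod_apply, Basis.piTensorProduct_repr_tprod_apply]
      congr 1
      exact Equiv.prod_comp (Equiv.addRight (1 : Fin p)) fun i => b.repr (f i) (x i)
  refine ⟨fun k => B.repr t fun _ => k, ?_⟩
  have h := sum_sub_sum_const_mem_range_cyclicNorm hp (cyclicShift F A p : _ →ₐ[F] _).toLinearMap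
    (f := fun x : Fin p → κ => B.repr t x • PiTensorProduct.tprod F fun i => b (x i)) ?_
  · have hsum : ∑ x : Fin p → κ, B.repr t x • PiTensorProduct.tprod F (fun i => b (x i)) = t := by
      conv_rhs => rw [← B.sum_repr t]
      simp only [B, Basis.piTensorProduct_apply]
    rw [hsum] at h
    exact h
  · intro x
    change _ = cyclicShift F A p _
    rw [map_smul, cyclicShift_tprod]
    congr 1
    conv_lhs => rw [← ht]
    exact hB t x

theorem one_notMem_range_cyclicNorm [CharP F p] [Nontrivial A] :
    (1 : ⨂[F] (_ : Fin p), A) ∉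
      LinearMap.range (cyclicNorm p (cyclicShift F A p : _ →ₐ[F] _).toLinearMap) := by
  obtain ⟨f, hf⟩ := (Algebra.linearMap F A).exists_leftInverse_of_injective
    (LinearMap.ker_eq_bot.2 (algebraMap F A).injective)
  have hf1 : f 1 = 1 := by simpa using LinearMap.congr_fun hf 1
  let ℓ : (⨂[F] (_ : Fin p), A) →ₗ[F] F := PiTensorProduct.lift
    ((MultilinearMap.mkPiAlgebra F (Fin p) F).compLinearMap fun _ => f)
  have hℓ : ∀ x : Fin p → A, ℓ (PiTensorProduct.tprod F x) = ∏ i, f (x i) := fun x => by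
    simp [ℓ]
  have hσ : ∀ t, ℓ (cyclicShift F A p t) = ℓ t := by
    intro t
    induction t using PiTensorProduct.induction_on with
    | add t t' h h' => rw [map_add, map_add, h, h', map_add]
    | smul_tprod r x =>
      rw [map_smul, map_smul, map_smul, cyclicShift_tprod, hℓ, hℓ]
      congr 1
      exact Equiv.prod_comp (Equiv.addRight (1 : Fin p)) fun i => f (x i)
  rintro ⟨t, ht⟩
  have h1 : ℓ 1 = 1 := by
    rw [PiTensorProduct.one_def, hℓ]
    simp [hf1]
  rw [← ht, cyclicNorm, LinearMap.sum_apply, map_sum] at h1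
  have h2 : ∀ i, ℓ (((cyclicShift F A p : _ →ₐ[F] _).toLinearMap ^ i) t) = ℓ t := by
    intro i
    induction i with
    | zero => rfl
    | succ i hi => rw [pow_succ', Module.End.mul_apply, ← hi]; exact hσ _
  rw [Finset.sum_congr rfl fun i _ => h2 i] at h1
  simp at h1

end CyclicShift

/-- A central simple algebra of exponent `p` is split by `F ^ (1 / p)`. -/
theorem exists_algHom_matrix_frobTwist {p : ℕ} [Fact p.Prime] {F : Type} [Field F] [CharP F p]
    {A : Type} [Ring A] [Algebra F A] [FiniteDimensional F A] [IsSimpleRing A]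
    [Algebra.IsCentral F A] (hexp : BrauerEquiv F (⨂[F] (_ : Fin p), A) F) :
    ∃ (n : ℕ) (_ : A →ₐ[F] Matrix (Fin n) (Fin n) (FrobTwist F p)), Module.finrank F A = n ^ 2 := by
  have hp := (Fact.out : p.Prime)
  have : NeZero p := ⟨hp.ne_zero⟩
  obtain ⟨W, _, _, _, ⟨φ⟩⟩ := hexp.exists_algEquiv_end
  let σ := cyclicShift F A p
  let I := normIdeal p σ
  have hI : ∀ r, r ∈ I ↔ (r : ⨂[F] (_ : Fin p), A) ∈
      LinearMap.range (cyclicNorm p (cyclicShift F A p : _ →ₐ[F] _).toLinearMap) := fun _ => Iff.rfl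
  obtain ⟨q, hq, hqq, hcomm⟩ := exists_idempotent_quotient_equalizer φ σ I fun h =>
    one_notMem_range_cyclicNorm ((hI 1).1 ((Ideal.eq_top_iff_one I).1 h))
  let P : A → AlgHom.equalizer (σ : _ →ₐ[F] _) (AlgHom.id F (⨂[F] (_ : Fin p), A)) := fun a =>
    ⟨PiTensorProduct.tprod F fun _ => a, cyclicShift_tprod _⟩
  let ν : A →+* _ ⧸ I :=
    { toFun a := Ideal.Quotient.mk I (P a)
      map_one' := rfl
      map_mul' a b := by
        rw [← map_mul]
        congr 1
        apply Subtype.ext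
        exact (PiTensorProduct.tprod_mul_tprod _ _).symm
      map_zero' := by
        rw [Ideal.Quotient.eq_zero_iff_mem, hI]
        have h : PiTensorProduct.tprod F (fun _ : Fin p => (0 : A)) = 0 :=
          MultilinearMap.map_coord_zero _ 0 rfl
        change PiTensorProduct.tprod F (fun _ : Fin p => (0 : A)) ∈ _
        rw [h]
        exact zero_mem _
      map_add' a b := by
        rw [← map_add, Ideal.Quotient.eq, hI]
        have h := tprod_sum_sub_sum_tprod_mem_range_cyclicNorm (F := F) hp ![a, b]
        simpa using h }
  let : Algebra (FrobTwist F p) (_ ⧸ I) := inferInstanceAs (Algebra F (_ ⧸ I))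
  refine exists_algHom_matrix_of_corner_commute (K := FrobTwist F p) ν (fun l => ?_) ?_ hq hqq hcomm
  · change Ideal.Quotient.mk I (P (algebraMap F A l)) = Ideal.Quotient.mk I (algebraMap F _ (l ^ p))
    congr 1
    apply Subtype.ext
    change PiTensorProduct.tprod F (fun _ : Fin p => algebraMap F A l) = algebraMap F _ (l ^ p)
    simp only [Algebra.algebraMap_eq_smul_one]
    rw [MultilinearMap.map_smul_univ (PiTensorProduct.tprod F) (fun _ => l) fun _ => (1 : A)]
    simp
    rfl
  · rw [eq_top_iff]
    rintro x -
    obtain ⟨t, rfl⟩ := Ideal.Quotient.mk_surjective x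
    obtain ⟨c, hc⟩ := exists_sub_sum_mem_range_cyclicNorm hp (Module.finBasis F A) t.2
    have h : Ideal.Quotient.mk I t = ∑ k, c k • ν (Module.finBasis F A k) := by
      have : Ideal.Quotient.mk I t = Ideal.Quotient.mk I (∑ k, c k • P (Module.finBasis F A k)) := by
        rw [Ideal.Quotient.eq, hI]
        simpa [P] using hc
      rw [this, map_sum]
      rfl
    rw [h]
    exact Submodule.sum_mem _ fun k _ =>
      Submodule.smul_mem (R := FrobTwist F p) _ (c k) (Submodule.subset_span ⟨_, rfl⟩)

theorem FrobTwist.finiteDimensional {p : ℕ} [Fact p.Prime] {F : Type} [Field F] [CharP F p] {d : ℕ}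
    (hd₁ : ∀ (n : ℕ) (φ : MvPolynomial (Fin n) F), φ.IsHomogeneous p →
      (∀ v : Fin n → F, MvPolynomial.eval v φ = 0 → v = 0) → n ≤ d) :
    FiniteDimensional F (FrobTwist F p) := by
  refine Module.rank_lt_aleph0_iff.1 (lt_of_le_of_lt (rank_le (n := d) fun S hS => ?_)
    (Cardinal.natCast_lt_aleph0 (n := d)))
  let e : S → F := fun i => (i : FrobTwist F p)
  rw [← Fintype.card_coe S]
  refine MvPolynomial.IsHomogeneous.card_le_of_anisotropic hd₁
    (φ := ∑ i : S, MvPolynomial.C (e i) * MvPolynomial.X i ^ p) ?_ fun v hv => ?_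
  · refine MvPolynomial.IsHomogeneous.sum _ _ _ fun i _ => ?_
    simpa using (MvPolynomial.isHomogeneous_C S (e i)).mul
      ((MvPolynomial.isHomogeneous_X F i).pow p)
  · funext i
    refine Fintype.linearIndependent_iff.1 hS v ?_ i
    refine Eq.trans (b := MvPolynomial.eval v _) ?_ hv
    rw [map_sum]
    refine Finset.sum_congr rfl fun i _ => ?_
    rw [Algebra.smul_def, map_mul, map_pow, MvPolynomial.eval_C, MvPolynomial.eval_X, mul_comm]
    rfl

theorem FrobTwist.pow_mem_range {p : ℕ} [Fact p.Prime] {F : Type} [Field F] [CharP F p]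
    (x : FrobTwist F p) : x ^ p ∈ (algebraMap F (FrobTwist F p)).range := ⟨x, rfl⟩

open scoped PiTensorProduct in
/-- If the maximal dimension of an anisotropic degree-`p` homogeneous form over `F` is a
finite `d > 1`, then every central simple `F`-algebra of exponent `p` is Brauer
equivalent to a tensor product of at most `⌈(d-1)/p⌉ - 1` symbol algebras of degree `p`. -/
theorem symbolLength_le (p : ℕ) (hp : p.Prime) (F : Type) [Field F] [CharP F p]
    (d : ℕ) (hd : 1 < d)
    (hd₁ : ∀ (n : ℕ) (φ : MvPolynomial (Fin n) F), φ.IsHomogeneous p →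
      (∀ v : Fin n → F, MvPolynomial.eval v φ = 0 → v = 0) → n ≤ d)
    (hd₂ : ∃ φ : MvPolynomial (Fin d) F, φ.IsHomogeneous p ∧
      (∀ v : Fin d → F, MvPolynomial.eval v φ = 0 → v = 0))
    (A : Type) [Ring A] [Algebra F A] [FiniteDimensional F A]
    [IsSimpleRing A] [Algebra.IsCentral F A]
    (hexp : BrauerEquiv F (⨂[F] (_ : Fin p), A) F) :
    ∃ (m : ℕ) (a b : Fin m → F), m ≤ (d - 1 + (p - 1)) / p - 1 ∧ (∀ i, b i ≠ 0) ∧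
      BrauerEquiv F A (⨂[F] i, SymbolAlg F p (a i) (b i)) := by
  have : Fact p.Prime := ⟨hp⟩
  have := FrobTwist.finiteDimensional hd₁
  obtain ⟨n, ρ, hn⟩ := exists_algHom_matrix_frobTwist hexp
  obtain ⟨k, a₀, b₀, hb₀, hA⟩ :=
    splitImpliesSymbolProduct_of_pow_mem (p := p) (F := F) FrobTwist.pow_mem_range A n ρ hn
  obtain ⟨m, a, b, hm, hb, hsum⟩ :=
    SymbolAlg.isSymbolMap_symbolClass.exists_sum_eq hd hd₁ k a₀ b₀ hb₀
  refine ⟨m, a, b, ?_, hb, BrauerMonoid.mk_eq_mk.1 ?_⟩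
  · have h : m + 1 ≤ (d - 1 + (p - 1)) / p := by
      rw [Nat.le_div_iff_mul_le hp.pos, add_mul, one_mul]
      have := hp.pos
      omega
    omega
  · rw [hA, BrauerMonoid.mk_piTensorProduct, ← SymbolAlg.val_sum_symbolClass a b hb, hsum,
      SymbolAlg.val_sum_symbolClass a₀ b₀ hb₀]
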